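/- arXiv:2509.13463 — 4 statements merged into one kernel-verified Lean document; each statement's English description precedes it below -/
import Mathlib

section
/- Let Δ and r be integers with Δ ≥ 2 and r ≥ Δ + 1, and let N_Δ denote the number of partitions of Δ−1. Then there exist N_Δ + 1 integer matrices A_0, …, A_{N_Δ}, each with r rows, rank r, and exactly binom(r+1,2) + (Δ−1)(r−1) columns, such that each A_i has nonzero pairwise non-parallel columns, every r×r submatrix of each A_i has determinant of absolute value at most Δ, and for all i ≠ j the column vector matroids of A_i and A_j are not isomorphic. -/
/-- Two integer vectors are parallel if they are linearly dependent over `ℚ`. -/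
def IntParallel {r : ℕ} (u v : Fin r → ℤ) : Prop :=
  ¬ LinearIndependent ℚ ![(fun i => (u i : ℚ)), (fun i => (v i : ℚ))]

/-- A matrix with `r` rows is `Δ`-modular if every `r × r` submatrix has
determinant of absolute value at most `Δ`. -/
def DeltaModular {r n : ℕ} (A : Matrix (Fin r) (Fin n) ℤ) (Δ : ℤ) : Prop :=
  ∀ f : Fin r → Fin n, Function.Injective f → |(A.submatrix id f).det| ≤ Δ

/-- The columns of `A` indexed by `S` are linearly independent over `ℝ`. -/
def ColsIndepR {r : ℕ} {ι : Type} (A : Matrix (Fin r) ι ℤ) (S : Set ι) : Prop :=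
  LinearIndependent ℝ (fun j : S => fun i => ((A i j.val : ℤ) : ℝ))

/-- The column vector matroids (over `ℝ`) of two integer matrices are isomorphic. -/
def MatroidIso {r r' : ℕ} {ι ι' : Type} (A : Matrix (Fin r) ι ℤ)
    (B : Matrix (Fin r') ι' ℤ) : Prop :=
  ∃ σ : ι ≃ ι', ∀ S : Set ι, ColsIndepR A S ↔ ColsIndepR B (σ '' S)

/-- A vector whose nonzero entries are among one `1` and one `-1`. -/
def IsNetworkVector {ι : Type*} (c : ι → ℤ) : Prop :=
  (∀ k, c k = 0 ∨ c k = 1 ∨ c k = -1) ∧ ∀ k l, c k = c l → c k ≠ 0 → k = l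

theorem IsNetworkVector.comp {ι κ : Type*} {c : ι → ℤ} (h : IsNetworkVector c) {f : κ → ι}
    (hf : Function.Injective f) : IsNetworkVector (c ∘ f) :=
  ⟨fun k => h.1 (f k), fun _ _ hkl hk => hf (h.2 _ _ hkl hk)⟩

/-- If the entries of a network vector do not cancel, at most one of them is nonzero. -/
theorem IsNetworkVector.eq_of_sum_ne_zero {ι : Type*} [Fintype ι] {c : ι → ℤ}
    (h : IsNetworkVector c) (hs : ∑ k, c k ≠ 0) {k l : ι} (hk : c k ≠ 0) (hl : c l ≠ 0) :
    k = l := by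
  classical
  by_contra hkl
  have hkl' : c k ≠ c l := fun e => hkl (h.2 _ _ e hk)
  apply hs
  rw [← Finset.sum_subset (Finset.subset_univ {k, l})]
  · rw [Finset.sum_pair hkl]
    rcases h.1 k with a | a | a <;> rcases h.1 l with b | b | b <;> simp_all
  · intro m _ hm
    simp only [Finset.mem_insert, Finset.mem_singleton, not_or] at hm
    by_contra hm0
    have h1 : c m ≠ c k := fun e => hm.1 (h.2 _ _ e hm0)
    have h2 : c m ≠ c l := fun e => hm.2 (h.2 _ _ e hm0)
    rcases h.1 k with a | a | a <;> rcases h.1 l with b | b | b <;>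
      rcases h.1 m with d | d | d <;> simp_all

theorem abs_det_le_one_of_isNetworkVector {n : ℕ} (M : Matrix (Fin n) (Fin n) ℤ)
    (h : ∀ t, IsNetworkVector (fun k => M k t)) : |M.det| ≤ 1 := by
  induction n with
  | zero => simp
  | succ n ih =>
    by_cases hs : ∀ t, ∑ k, M k t = 0
    · have : M.det = 0 := by
        rw [← Matrix.exists_vecMul_eq_zero_iff]
        refine ⟨fun _ => 1, fun e => one_ne_zero (congrFun e 0), ?_⟩
        ext t
        simpa [Matrix.vecMul, dotProduct] using hs t
      simp [this]
    · push Not at hs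
      obtain ⟨t, ht⟩ := hs
      obtain ⟨k, -, hk⟩ := Finset.exists_ne_zero_of_sum_ne_zero ht
      have h0 : ∀ l, l ≠ k → M l t = 0 := fun l hl => by
        by_contra hl0
        exact hl ((h t).eq_of_sum_ne_zero ht hl0 hk)
      rw [Matrix.det_succ_column M t, Finset.sum_eq_single k]
      · have hm := ih (M.submatrix k.succAbove t.succAbove) fun s =>
          (h (t.succAbove s)).comp Fin.succAbove_right_injective
        have hk1 : |M k t| ≤ 1 := by
          rcases (h t).1 k with e | e | e <;> simp [e]
        rw [abs_mul, abs_mul, abs_pow, abs_neg, abs_one, one_pow, one_mul]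
        exact mul_le_one₀ hk1 (abs_nonneg _) hm
      · intro l _ hl
        simp [h0 l hl]
      · simp

/-- The edges of the complete graph on `Fin r`, each oriented from its smaller end. -/
abbrev OrientedEdge (r : ℕ) := {p : Fin r × Fin r // p.1 < p.2}

/-- The elements of the lifted-graphic matroid given by vertex weights `w`: an extra point and,
for every edge `ij` of the complete graph, one element for each gain in `[-w j, w i]`. -/
abbrev GainElement {r : ℕ} (w : Fin r → ℕ) :=
  Option (Σ p : OrientedEdge r, Fin (w p.1.1 + w p.1.2 + 1))

namespace GainElement

/-- The gain of an element. -/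
def gain {r : ℕ} {w : Fin r → ℕ} : GainElement w → ℤ
  | none => 1
  | some x => (x.2 : ℤ) - w x.1.1.2

/-- The signed incidence vector of an element. -/
def incidence {r : ℕ} {w : Fin r → ℕ} : GainElement w → Fin r → ℤ
  | none => 0
  | some x => fun v => if v = x.1.1.1 then 1 else if v = x.1.1.2 then -1 else 0

theorem sum_incidence {r : ℕ} {w : Fin r → ℕ} (x : GainElement w) : ∑ v, x.incidence v = 0 := by
  rcases x with _ | ⟨⟨⟨i, j⟩, hij⟩, g⟩
  · simp [incidence]
  · have hji : j ≠ i := ne_of_gt hij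
    have : ∀ v, incidence (some ⟨⟨⟨i, j⟩, hij⟩, g⟩ : GainElement w) v =
        (if v = i then 1 else 0) + (if v = j then -1 else 0) := by
      intro v
      simp only [incidence]
      split_ifs <;> simp_all
    simp [this, Finset.sum_add_distrib]

end GainElement

/-- The matrix of the lifted-graphic matroid with vertex weights `w`: the gains in row `0`, and
the incidence vectors in the other rows. -/
def gainMatrix {n : ℕ} (w : Fin (n + 1) → ℕ) : Matrix (Fin (n + 1)) (GainElement w) ℤ :=
  fun k x => if k = 0 then x.gain else x.incidence k

namespace GainElement

variable {n : ℕ} {w : Fin (n + 1) → ℕ}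

/-- Square submatrix of incidence vectors with a prescribed row `0`. -/
def rowMatrix (x : Fin (n + 1) → GainElement w) (u : Fin (n + 1) → ℤ) :
    Matrix (Fin (n + 1)) (Fin (n + 1)) ℤ :=
  Matrix.updateRow (Matrix.of fun k t => (x t).incidence k) 0 u

theorem rowMatrix_apply (x : Fin (n + 1) → GainElement w) (u : Fin (n + 1) → ℤ) (k t) :
    rowMatrix x u k t = if k = 0 then u t else (x t).incidence k := by
  rw [rowMatrix, Matrix.updateRow_apply]
  rfl

/-- The determinant as a linear function of row `0`. -/
def rowDet (x : Fin (n + 1) → GainElement w) : (Fin (n + 1) → ℤ) →ₗ[ℤ] ℤ :=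
  (Matrix.detRowAlternating (n := Fin (n + 1)) (R := ℤ)).toMultilinearMap.toLinearMap
    (fun k t => (x t).incidence k) 0

theorem rowDet_apply (x : Fin (n + 1) → GainElement w) (u : Fin (n + 1) → ℤ) :
    rowDet x u = (rowMatrix x u).det := rfl

/-- The contribution of the `m`-th unit of weight at the vertex `v` to the gain of an element. -/
def unitGain (v : Fin (n + 1)) (m : ℕ) : GainElement w → ℤ
  | none => 0
  | some x => if v = x.1.1.1 then if (m : ℤ) < (x.2 : ℤ) - w x.1.1.2 then 1 else 0
      else if v = x.1.1.2 then if (m : ℤ) < w x.1.1.2 - (x.2 : ℤ) then -1 else 0 else 0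

theorem sum_range_lt (a : ℕ) (z : ℤ) (hz : z ≤ a) (c : ℤ) :
    ∑ m ∈ Finset.range a, (if (m : ℤ) < z then c else 0) = z.toNat * c := by
  have : ∀ m : ℕ, ((m : ℤ) < z) ↔ m < z.toNat := by omega
  simp only [this]
  rw [← Finset.sum_filter, Finset.sum_const]
  have : (Finset.range a).filter (· < z.toNat) = Finset.range z.toNat := by
    ext m
    simp
    omega
  rw [this, Finset.card_range, nsmul_eq_mul]

theorem gain_eq_sum_unitGain {x : GainElement w} (hx : x ≠ none) :
    x.gain = ∑ v, ∑ m ∈ Finset.range (w v), x.unitGain v m := by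
  rcases x with _ | ⟨⟨⟨i, j⟩, hij⟩, g, hg⟩
  · exact absurd rfl hx
  · have hji : j ≠ i := ne_of_gt hij
    simp only at hg
    rw [← Finset.sum_subset (Finset.subset_univ {i, j}), Finset.sum_pair hji.symm]
    · simp only [unitGain, gain, if_true, if_neg hji]
      rw [sum_range_lt _ _ (by omega), sum_range_lt _ _ (by omega)]
      omega
    · intro v _ hv
      simp only [Finset.mem_insert, Finset.mem_singleton, not_or] at hv
      simp [unitGain, hv.1, hv.2]

theorem abs_rowDet_unitGain (x : Fin (n + 1) → GainElement w) (v : Fin (n + 1)) (m : ℕ) :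
    |rowDet x (fun t => (x t).unitGain v m)| ≤ 1 := by
  rw [rowDet_apply]
  set u : Fin (n + 1) → ℤ := fun t => (x t).unitGain v m with hu
  let M' : Matrix (Fin (n + 1)) (Fin (n + 1)) ℤ := fun k t =>
    if k = 0 then u t else if k = v then (x t).incidence k - u t else (x t).incidence k
  have hdet : (rowMatrix x u).det = M'.det := by
    by_cases hv : v = 0
    · congr 1
      ext k t
      simp only [rowMatrix_apply, M', hv]
      split_ifs <;> rfl
    · rw [← Matrix.det_updateRow_add_smul_self (rowMatrix x u) hv (-1)]
      congr 1
      ext k t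
      by_cases hk : k = v
      · subst hk
        simp [rowMatrix_apply, M', hv, sub_eq_add_neg]
      · simp [rowMatrix_apply, M', hk, Matrix.updateRow_apply]
  rw [hdet]
  refine abs_det_le_one_of_isNetworkVector _ fun t => ?_
  rcases hx : x t with _ | ⟨⟨⟨i, j⟩, hij⟩, g⟩
  · simp [IsNetworkVector, M', hu, hx, unitGain, incidence]
  · have hij' : i < j := hij
    have hji : j ≠ i := ne_of_gt hij
    simp only [IsNetworkVector, M', hu, hx, unitGain, incidence]
    constructor
    · intro k
      grind
    · intro k l
      grind

theorem abs_det_gainMatrix_le (x : Fin (n + 1) → GainElement w) (hw : 0 < ∑ v, w v) :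
    |((gainMatrix w).submatrix id x).det| ≤ ∑ v, (w v : ℤ) := by
  have h : ((gainMatrix w).submatrix id x).det = rowDet x fun t => (x t).gain := by
    rw [rowDet_apply]
    congr 1
    ext k t
    simp [rowMatrix_apply, gainMatrix]
  rw [h]
  by_cases hx : ∃ t, x t = none
  · obtain ⟨s, hs⟩ := hx
    have h1 : rowDet x ((fun t => (x t).gain) - Pi.single s 1) = 0 := by
      rw [rowDet_apply]
      refine Matrix.det_eq_zero_of_column_eq_zero s fun k => ?_
      rw [rowMatrix_apply]
      split_ifs <;> simp [hs, gain, incidence]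
    rw [map_sub, sub_eq_zero] at h1
    rw [h1, rowDet_apply]
    refine (abs_det_le_one_of_isNetworkVector _ fun t => ?_).trans (by exact_mod_cast hw)
    simp only [IsNetworkVector, rowMatrix_apply, Pi.single_apply]
    rcases hx : x t with _ | ⟨⟨⟨i, j⟩, hij⟩, g⟩
    · simp only [incidence, Pi.zero_apply]
      grind
    · have hts : t ≠ s := fun e => by simp [← e, hx] at hs
      have hji : j ≠ i := ne_of_gt hij
      simp only [incidence, if_neg hts]
      grind
  · push Not at hx
    have : (fun t => (x t).gain) =
        ∑ v, ∑ m ∈ Finset.range (w v), fun t => (x t).unitGain v m := by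
      ext t
      simp [gain_eq_sum_unitGain (hx t)]
    rw [this]
    simp only [map_sum]
    refine (Finset.abs_sum_le_sum_abs _ _).trans (Finset.sum_le_sum fun v _ => ?_)
    refine (Finset.abs_sum_le_sum_abs _ _).trans ?_
    refine (Finset.sum_le_sum fun m _ => abs_rowDet_unitGain x v m).trans ?_
    simp

end GainElement

namespace OrientedEdge

/-- Two different edges are distinguished by an end of the first. -/
theorem exists_end {r : ℕ} {p q : OrientedEdge r} (h : p ≠ q) :
    ∃ v, (v = p.1.1 ∨ v = p.1.2) ∧ v ≠ q.1.1 ∧ v ≠ q.1.2 := by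
  by_contra! hc
  obtain ⟨⟨i, j⟩, hij⟩ := p
  obtain ⟨⟨k, l⟩, hkl⟩ := q
  have h1 := hc i (Or.inl rfl)
  have h2 := hc j (Or.inr rfl)
  simp only [ne_eq, Subtype.mk.injEq, Prod.mk.injEq] at *
  grind

end OrientedEdge

namespace GainElement

variable {n : ℕ} {w : Fin (n + 1) → ℕ}

theorem incidence_ne_zero_iff {r : ℕ} {w : Fin r → ℕ} 
    {x : Σ p : OrientedEdge r, Fin (w p.1.1 + w p.1.2 + 1)} (v : Fin r) :
    incidence (some x : GainElement w) v ≠ 0 ↔ v = x.1.1.1 ∨ v = x.1.1.2 := by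
  simp only [incidence]
  split_ifs <;> simp_all

/-- Linear relations between columns extend to the incidence vectors at all vertices. -/
theorem relation_incidence {K : Type*} [Field K] {s t u : K} {a b c : GainElement w}
    (h : ∀ k, s * gainMatrix w k a + t * gainMatrix w k b + u * gainMatrix w k c = 0) :
    s * a.gain + t * b.gain + u * c.gain = 0 ∧
      ∀ v, s * a.incidence v + t * b.incidence v + u * c.incidence v = 0 := by
  have hsucc : ∀ k : Fin n, s * a.incidence k.succ + t * b.incidence k.succ +
      u * c.incidence k.succ = 0 := fun k => by
    simpa [gainMatrix, Fin.succ_ne_zero] using h k.succ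
  refine ⟨by simpa [gainMatrix] using h 0, fun v => ?_⟩
  refine Fin.cases ?_ hsucc v
  have hz : ∀ x : GainElement w,
      (x.incidence 0 : K) = -∑ k : Fin n, (x.incidence k.succ : K) := fun x => by
    have := x.sum_incidence
    rw [Fin.sum_univ_succ, add_eq_zero_iff_eq_neg] at this
    rw [this]
    push_cast
    rfl
  have hs := Finset.sum_eq_zero fun k (_ : k ∈ Finset.univ) => hsucc k
  rw [Finset.sum_add_distrib, Finset.sum_add_distrib, ← Finset.mul_sum, ← Finset.mul_sum,
    ← Finset.mul_sum] at hs
  rw [hz, hz, hz]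
  linear_combination -hs

/-- Elements on the same edge with the same gain agree. -/
theorem eq_of_gain_eq {p : OrientedEdge (n + 1)} {g h : Fin (w p.1.1 + w p.1.2 + 1)}
    (e : gain (some ⟨p, g⟩ : GainElement w) = gain (some ⟨p, h⟩ : GainElement w)) : g = h := by
  simp only [gain] at e
  exact Fin.ext (by omega)

theorem exists_incidence {x y : Σ p : OrientedEdge (n + 1), Fin (w p.1.1 + w p.1.2 + 1)}
    (h : x.1 ≠ y.1) : ∃ v, incidence (some x : GainElement w) v ≠ 0 ∧
      incidence (some y : GainElement w) v = 0 := by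
  obtain ⟨v, h1, h2⟩ := OrientedEdge.exists_end h
  refine ⟨v, (incidence_ne_zero_iff v).2 h1, ?_⟩
  by_contra h3
  rcases (incidence_ne_zero_iff v).1 h3 with h3 | h3
  exacts [h2.1 h3, h2.2 h3]

/-- Different columns are linearly independent. -/
theorem pair_independent {K : Type*} [Field K] [CharZero K] {a b : GainElement w} (hab : a ≠ b)
    {s t : K} (h : ∀ k, s * gainMatrix w k a + t * gainMatrix w k b = 0) : s = 0 ∧ t = 0 := by
  obtain ⟨hg, hv⟩ := relation_incidence (s := s) (t := t) (u := 0) (a := a) (b := b) (c := b)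
    (by simpa using h)
  simp only [zero_mul, add_zero] at hg hv
  rcases a with _ | x <;> rcases b with _ | y
  · exact absurd rfl hab
  · have := hv y.1.1.1
    simp [incidence] at this
    simpa [this, gain] using hg
  · have := hv x.1.1.1
    simp [incidence] at this
    simpa [this, gain] using hg
  · by_cases hxy : x.1 = y.1
    · obtain ⟨p, g⟩ := x
      obtain ⟨q, g'⟩ := y
      obtain rfl : p = q := hxy
      have h1 := hv p.1.1
      simp only [incidence, if_true, Int.cast_one, mul_one] at h1
      have hst : t = -s := by linear_combination h1
      rw [hst] at hg
      have h2 : s * ((gain (some ⟨p, g⟩ : GainElement w) : K) -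
          gain (some ⟨p, g'⟩ : GainElement w)) = 0 := by linear_combination hg
      have hs : s = 0 := by
        refine (mul_eq_zero.1 h2).resolve_right fun e => hab ?_
        rw [eq_of_gain_eq (Int.cast_injective (sub_eq_zero.1 e))]
      simp [hst, hs]
    · obtain ⟨v, h1, h2⟩ := exists_incidence hxy
      obtain ⟨v', h1', h2'⟩ := exists_incidence (Ne.symm hxy)
      constructor
      · simpa [h1, h2] using hv v
      · simpa [h1', h2'] using hv v'

theorem colsIndepR_pair {a b : GainElement w} (hab : a ≠ b) : ColsIndepR (gainMatrix w) {a, b} := by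
  refine (LinearIndepOn.pair_iff (fun j i => ((gainMatrix w i j : ℤ) : ℝ)) hab).2 fun s t h => ?_
  exact pair_independent hab fun k => by simpa using congrFun h k

theorem not_colsIndepR_triple_iff {a b c : GainElement w} (hab : a ≠ b) (hca : c ≠ a)
    (hcb : c ≠ b) : ¬ ColsIndepR (gainMatrix w) {c, a, b} ↔
      ∃ s t : ℝ, ∀ k, s * gainMatrix w k a + t * gainMatrix w k b = gainMatrix w k c := by
  have := linearIndepOn_insert (K := ℝ) (f := fun j i => ((gainMatrix w i j : ℤ) : ℝ))
    (s := {a, b}) (a := c) (by simp [hca, hcb])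
  have h' : ColsIndepR (gainMatrix w) {c, a, b} ↔ _ := this
  have hp : LinearIndepOn ℝ (fun j i => ((gainMatrix w i j : ℤ) : ℝ)) {a, b} := colsIndepR_pair hab
  rw [h', and_iff_right hp, not_not, Set.image_pair,
    Submodule.mem_span_pair]
  simp only [funext_iff, Pi.add_apply, Pi.smul_apply, smul_eq_mul]

/-- A line through two elements on different edges contains at most one further element. -/
theorem eq_of_not_colsIndepR_of_edge_ne {x y : Σ p : OrientedEdge (n + 1), Fin (w p.1.1 + w p.1.2 + 1)}
    (hxy : x.1 ≠ y.1) {a b : GainElement w} (hax : a ≠ some x) (hay : a ≠ some y)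
    (hbx : b ≠ some x) (hby : b ≠ some y)
    (ha : ¬ ColsIndepR (gainMatrix w) {a, some x, some y})
    (hb : ¬ ColsIndepR (gainMatrix w) {b, some x, some y}) : a = b := by
  have hne : (some x : GainElement w) ≠ some y := fun e => hxy (by rw [Option.some.inj e])
  obtain ⟨v, hv, hv'⟩ := exists_incidence hxy
  obtain ⟨u, hu, hu'⟩ := exists_incidence (Ne.symm hxy)
  have huv : u ≠ v := fun e => hu (e ▸ hv')
  have key : ∀ c : GainElement w, c ≠ some x → c ≠ some y →
      ¬ ColsIndepR (gainMatrix w) {c, some x, some y} →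
      ∃ z, c = some z ∧ (v = z.1.1.1 ∨ v = z.1.1.2) ∧ (u = z.1.1.1 ∨ u = z.1.1.2) ∧
        ∃ s t : ℝ, s * gain (some x) + t * gain (some y) = c.gain ∧
          ∀ v, s * incidence (some x) v + t * incidence (some y) v = c.incidence v := by
    intro c hcx hcy hc
    obtain ⟨s, t, hst⟩ := (not_colsIndepR_triple_iff hne hcx hcy).1 hc
    obtain ⟨hg, hi⟩ := relation_incidence (s := s) (t := t) (u := -1) (a := some x) (b := some y)
      (c := c) (fun k => by linear_combination hst k)
    have hs : s ≠ 0 := by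
      rintro rfl
      have := (pair_independent (K := ℝ) (s := t) (t := -1) (Ne.symm hcy) fun k => by
        linear_combination hst k).2
      norm_num at this
    have ht : t ≠ 0 := by
      rintro rfl
      have := (pair_independent (K := ℝ) (s := s) (t := -1) (Ne.symm hcx) fun k => by
        linear_combination hst k).2
      norm_num at this
    have hcv : c.incidence v ≠ 0 := fun e => by
      have := hi v
      simp [e, hv', hs, hv] at this
    have hcu : c.incidence u ≠ 0 := fun e => by
      have := hi u
      simp [e, hu', ht, hu] at this
    rcases c with _ | z
    · simp [incidence] at hcv
    · refine ⟨z, rfl, (incidence_ne_zero_iff v).1 hcv, (incidence_ne_zero_iff u).1 hcu, s, t,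
        by linear_combination hg, fun v => by linear_combination hi v⟩
  obtain ⟨⟨⟨⟨i, j⟩, hij⟩, g⟩, rfl, h1, h2, s, t, hg, hi⟩ := key a hax hay ha
  obtain ⟨⟨⟨⟨k, l⟩, hkl⟩, g'⟩, rfl, h1', h2', s', t', hg', hi'⟩ := key b hbx hby hb
  have hik : i = k ∧ j = l := by
    simp only at h1 h2 h1' h2' hij hkl
    grind
  obtain ⟨rfl, rfl⟩ := hik
  have hs : s = s' := by
    have e := (hi v).trans (hi' v).symm
    simpa [hv', hv] using e
  have ht : t = t' := by
    have e := (hi u).trans (hi' u).symm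
    simpa [hu', hu] using e
  subst hs ht
  rw [eq_of_gain_eq (Int.cast_injective (hg.symm.trans hg'))]

end GainElement

theorem MatroidIso.symm {r r' : ℕ} {ι ι' : Type} {A : Matrix (Fin r) ι ℤ}
    {B : Matrix (Fin r') ι' ℤ} (h : MatroidIso A B) : MatroidIso B A := by
  obtain ⟨σ, h⟩ := h
  exact ⟨σ.symm, fun S => by rw [h (σ.symm '' S), Equiv.image_symm_image]⟩

theorem matroidIso_submatrix {r : ℕ} {ι ι' : Type} (A : Matrix (Fin r) ι ℤ) (e : ι' ≃ ι) :
    MatroidIso (A.submatrix id e) A := by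
  refine ⟨e, fun S => ?_⟩
  exact linearIndependent_equiv (e.image S)
    (f := fun j : e '' S => fun i => ((A i j.val : ℤ) : ℝ))

/-- A maximal collinear set of at least four columns. -/
def IsLongLine {r : ℕ} {ι : Type} (A : Matrix (Fin r) ι ℤ) (L : Finset ι) : Prop :=
  4 ≤ L.card ∧
    (∀ a ∈ L, ∀ b ∈ L, ∀ c ∈ L, a ≠ b → c ≠ a → c ≠ b → ¬ ColsIndepR A {c, a, b}) ∧
    ∀ x, x ∉ L → ∃ a ∈ L, ∃ b ∈ L, a ≠ b ∧ ColsIndepR A {x, a, b}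

/-- The number of maximal collinear sets of `m` columns, for `m ≥ 4`. -/
noncomputable def longLineCount {r : ℕ} {ι : Type} (A : Matrix (Fin r) ι ℤ) (m : ℕ) : ℕ :=
  {L : Finset ι | IsLongLine A L ∧ L.card = m}.ncard

theorem IsLongLine.map {r r' : ℕ} {ι ι' : Type} {A : Matrix (Fin r) ι ℤ}
    {B : Matrix (Fin r') ι' ℤ} {σ : ι ≃ ι'}
    (h : ∀ S : Set ι, ColsIndepR A S ↔ ColsIndepR B (σ '' S)) {L : Finset ι}
    (hL : IsLongLine A L) : IsLongLine B (L.map σ.toEmbedding) := by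
  have h3 : ∀ a b c, ColsIndepR B {σ c, σ a, σ b} ↔ ColsIndepR A {c, a, b} := fun a b c => by
    rw [h, Set.image_insert_eq, Set.image_pair]
  obtain ⟨h4, hd, hm⟩ := hL
  refine ⟨by simpa using h4, ?_, fun x hx => ?_⟩
  · simp only [Finset.mem_map, Equiv.coe_toEmbedding, forall_exists_index, and_imp,
      forall_apply_eq_imp_iff₂, h3, ne_eq, EmbeddingLike.apply_eq_iff_eq]
    exact hd
  · obtain ⟨x, rfl⟩ := σ.surjective x
    obtain ⟨a, ha, b, hb, hab, hi⟩ := hm x (by simpa using hx)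
    exact ⟨σ a, by simpa using ha, σ b, by simpa using hb, by simpa using hab, (h3 a b x).2 hi⟩

theorem MatroidIso.longLineCount_le {r r' : ℕ} {ι ι' : Type} [Finite ι'] {A : Matrix (Fin r) ι ℤ}
    {B : Matrix (Fin r') ι' ℤ} (h : MatroidIso A B) (m : ℕ) :
    longLineCount A m ≤ longLineCount B m := by
  obtain ⟨σ, h⟩ := h
  refine Set.ncard_le_ncard_of_injOn (Finset.map σ.toEmbedding) ?_
    (Finset.map_injective _).injOn (Set.toFinite _)
  rintro L ⟨hL, hc⟩
  exact ⟨hL.map h, by simpa using hc⟩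

theorem MatroidIso.longLineCount_eq {r r' : ℕ} {ι ι' : Type} [Finite ι] [Finite ι']
    {A : Matrix (Fin r) ι ℤ} {B : Matrix (Fin r') ι' ℤ} (h : MatroidIso A B) (m : ℕ) :
    longLineCount A m = longLineCount B m :=
  (h.longLineCount_le m).antisymm (h.symm.longLineCount_le m)

namespace GainElement

variable {n : ℕ} {w : Fin (n + 1) → ℕ}

/-- The extra point together with the elements on a given edge. -/
def edgeLine (w : Fin (n + 1) → ℕ) (p : OrientedEdge (n + 1)) : Finset (GainElement w) :=
  Finset.insertNone (Finset.univ.map ⟨Sigma.mk p, sigma_mk_injective⟩)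

theorem none_mem_edgeLine (p : OrientedEdge (n + 1)) : none ∈ edgeLine w p := by
  simp [edgeLine]

theorem some_mem_edgeLine {p : OrientedEdge (n + 1)}
    {x : Σ p : OrientedEdge (n + 1), Fin (w p.1.1 + w p.1.2 + 1)} :
    some x ∈ edgeLine w p ↔ x.1 = p := by
  obtain ⟨q, g⟩ := x
  simp only [edgeLine, Finset.some_mem_insertNone, Finset.mem_map, Finset.mem_univ, true_and]
  constructor
  · rintro ⟨g', h⟩
    exact (congrArg Sigma.fst h).symm
  · rintro rfl
    exact ⟨g, rfl⟩

theorem card_edgeLine (p : OrientedEdge (n + 1)) :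
    (edgeLine w p).card = w p.1.1 + w p.1.2 + 2 := by
  simp [edgeLine]

theorem edgeLine_injective : Function.Injective (edgeLine w) := fun p q h => by
  have : (some ⟨p, 0⟩ : GainElement w) ∈ edgeLine w q := by
    rw [← h]
    exact some_mem_edgeLine.2 rfl
  exact some_mem_edgeLine.1 this

theorem not_colsIndepR_of_mem_edgeLine {p : OrientedEdge (n + 1)} {a b c : GainElement w}
    (ha : a ∈ edgeLine w p) (hb : b ∈ edgeLine w p) (hc : c ∈ edgeLine w p) (hab : a ≠ b)
    (hca : c ≠ a) (hcb : c ≠ b) : ¬ ColsIndepR (gainMatrix w) {c, a, b} := by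
  rw [not_colsIndepR_triple_iff hab hca hcb]
  set ε : GainElement w → ℝ := fun x => if x = none then 0 else 1 with hε
  have key : ∀ x ∈ edgeLine w p, ∀ k, (gainMatrix w k x : ℝ) = if k = 0 then (x.gain : ℝ) else
      ε x * incidence (some ⟨p, 0⟩ : GainElement w) k := by
    intro x hx k
    rcases x with _ | ⟨q, g⟩
    · by_cases hk : k = 0 <;> simp [gainMatrix, hk, incidence, hε]
    · obtain rfl : q = p := some_mem_edgeLine.1 hx
      by_cases hk : k = 0 <;> simp [gainMatrix, hk, incidence, hε]
  have hD : (a.gain : ℝ) * ε b - b.gain * ε a ≠ 0 := by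
    rcases a with _ | ⟨q, g⟩ <;> rcases b with _ | ⟨q', g'⟩
    · exact absurd rfl hab
    · simp [hε, gain]
    · simp [hε, gain]
    · obtain rfl : q = p := some_mem_edgeLine.1 ha
      obtain rfl : q' = q := some_mem_edgeLine.1 hb
      simp only [hε, reduceCtorEq, if_false, mul_one]
      refine fun e => hab ?_
      rw [eq_of_gain_eq (Int.cast_injective (sub_eq_zero.1 e))]
  refine ⟨(c.gain * ε b - b.gain * ε c) / (a.gain * ε b - b.gain * ε a),
    (a.gain * ε c - c.gain * ε a) / (a.gain * ε b - b.gain * ε a), fun k => ?_⟩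
  rw [key a ha, key b hb, key c hc, div_mul_eq_mul_div, div_mul_eq_mul_div, ← add_div,
    div_eq_iff hD]
  split_ifs <;> ring

theorem isLongLine_edgeLine {p : OrientedEdge (n + 1)} (hp : 2 ≤ w p.1.1 + w p.1.2) :
    IsLongLine (gainMatrix w) (edgeLine w p) := by
  refine ⟨by rw [card_edgeLine]; omega,
    fun a ha b hb c hc => not_colsIndepR_of_mem_edgeLine ha hb hc,
    fun x hx => ?_⟩
  refine ⟨none, none_mem_edgeLine p, some ⟨p, 0⟩, some_mem_edgeLine.2 rfl, by simp, ?_⟩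
  rcases x with _ | x
  · exact absurd (none_mem_edgeLine p) hx
  have hxp : x.1 ≠ p := fun e => hx (some_mem_edgeLine.2 e)
  by_contra h
  obtain ⟨s, t, hst⟩ := (not_colsIndepR_triple_iff (by simp) (by simp)
    (fun e => hxp (by rw [Option.some.inj e]))).1 h
  obtain ⟨-, hi⟩ := relation_incidence (s := s) (t := t) (u := -1) (a := none)
    (b := some ⟨p, 0⟩) (c := some x) (fun k => by linear_combination hst k)
  obtain ⟨v, hv, hv'⟩ := exists_incidence (x := x) (y := ⟨p, 0⟩) hxp
  have h0 : incidence (none : GainElement w) v = 0 := rfl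
  have := hi v
  rw [h0, hv'] at this
  simp [hv] at this

theorem isLongLine_gainMatrix_iff {L : Finset (GainElement w)} :
    IsLongLine (gainMatrix w) L ↔ ∃ p, 2 ≤ w p.1.1 + w p.1.2 ∧ edgeLine w p = L := by
  constructor
  · rintro ⟨h4, hd, hm⟩
    have hsame : ∀ x y, some x ∈ L → some y ∈ L → x.1 = y.1 := by
      intro x y hx hy
      by_contra hxy
      have hcard : 1 < ((L.erase (some x)).erase (some y)).card := by
        have h1 := Finset.pred_card_le_card_erase (s := L) (a := some x)
        have h2 := Finset.pred_card_le_card_erase (s := L.erase (some x)) (a := some y)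
        omega
      obtain ⟨a, ha, b, hb, hab⟩ := Finset.one_lt_card.1 hcard
      simp only [Finset.mem_erase] at ha hb
      have hne : (some x : GainElement w) ≠ some y := fun e => hxy (by rw [Option.some.inj e])
      exact hab (eq_of_not_colsIndepR_of_edge_ne hxy ha.2.1 ha.1 hb.2.1 hb.1
        (hd _ hx _ hy _ ha.2.2 hne ha.2.1 ha.1) (hd _ hx _ hy _ hb.2.2 hne hb.2.1 hb.1))
    obtain ⟨z, hz, hz0⟩ : ∃ z ∈ L, z ≠ none := by
      obtain ⟨a, ha, b, hb, hab⟩ := Finset.one_lt_card.1 (show 1 < L.card by omega)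
      by_cases h : a = none
      · exact ⟨b, hb, fun e => hab (h.trans e.symm)⟩
      · exact ⟨a, ha, h⟩
    obtain ⟨z, rfl⟩ := Option.ne_none_iff_exists'.1 hz0
    have hsub : L ⊆ edgeLine w z.1 := fun x hx => by
      rcases x with _ | x
      · exact none_mem_edgeLine _
      · exact some_mem_edgeLine.2 (hsame _ _ hx hz)
    have heq : edgeLine w z.1 = L := by
      refine Finset.Subset.antisymm (fun x hx => ?_) hsub
      by_contra hxL
      obtain ⟨a, ha, b, hb, hab, hi⟩ := hm x hxL
      exact not_colsIndepR_of_mem_edgeLine (hsub ha) (hsub hb) hx hab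
        (fun e => hxL (e ▸ ha)) (fun e => hxL (e ▸ hb)) hi
    refine ⟨z.1, ?_, heq⟩
    rw [← heq, card_edgeLine] at h4
    omega
  · rintro ⟨p, hp, rfl⟩
    exact isLongLine_edgeLine hp

theorem longLineCount_gainMatrix {m : ℕ} (hm : 2 ≤ m) :
    longLineCount (gainMatrix w) (m + 2) =
      (Finset.univ.filter fun p : OrientedEdge (n + 1) => w p.1.1 + w p.1.2 = m).card := by
  rw [← Finset.card_map ⟨edgeLine w, edgeLine_injective⟩, ← Set.ncard_coe_finset, longLineCount]
  congr 1
  ext L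
  simp only [isLongLine_gainMatrix_iff, Set.mem_ofPred_eq, Finset.coe_map, Set.mem_image,
    Finset.mem_coe, Finset.mem_filter, Finset.mem_univ, true_and, Function.Embedding.coeFn_mk]
  constructor
  · rintro ⟨⟨p, -, rfl⟩, hc⟩
    rw [card_edgeLine] at hc
    exact ⟨p, by omega, rfl⟩
  · rintro ⟨p, hp, rfl⟩
    exact ⟨⟨p, by omega, rfl⟩, by rw [card_edgeLine, hp]⟩

end GainElement

theorem sum_sum_eq_two_nsmul_add {r : ℕ} {M : Type*} [AddCommMonoid M] (F : Fin r → Fin r → M)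
    (hF : ∀ i j, F i j = F j i) :
    ∑ i, ∑ j, F i j = 2 • (∑ p : OrientedEdge r, F p.1.1 p.1.2) + ∑ i, F i i := by
  rw [← Finset.sum_subtype (Finset.univ.filter fun x : Fin r × Fin r => x.1 < x.2) (by simp)
    (fun x => F x.1 x.2), Finset.sum_filter, Fintype.sum_prod_type, two_nsmul]
  nth_rewrite 3 [Finset.sum_comm]
  simp only [← Finset.sum_add_distrib]
  refine Finset.sum_congr rfl fun i _ => ?_
  have hdiag : F i i = ∑ j, if i = j then F i j else 0 := by simp
  rw [hdiag]
  simp only [← Finset.sum_add_distrib]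
  refine Finset.sum_congr rfl fun j _ => ?_
  rcases lt_trichotomy i j with h | rfl | h
  · simp [h, h.not_gt, h.ne]
  · simp
  · simp [h, h.not_gt, h.ne', hF i j]

theorem sum_weight_orientedEdge {n : ℕ} (w : Fin (n + 1) → ℕ) :
    ∑ p : OrientedEdge (n + 1), (w p.1.1 + w p.1.2) = n * ∑ v, w v := by
  have h := sum_sum_eq_two_nsmul_add (fun i j => w i + w j) fun i j => add_comm _ _
  simp only [Finset.sum_add_distrib, Finset.sum_const, Finset.card_univ, Fintype.card_fin,
    smul_eq_mul, ← Finset.mul_sum] at h ⊢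
  linarith

theorem two_mul_card_orientedEdge (n : ℕ) :
    2 * Fintype.card (OrientedEdge (n + 1)) = n * (n + 1) := by
  have h := sum_sum_eq_two_nsmul_add (fun _ _ : Fin (n + 1) => 1) fun i j => rfl
  simp only [Finset.sum_const, Finset.card_univ, Fintype.card_fin, smul_eq_mul, mul_one] at h
  linarith

theorem card_gainElement {n d : ℕ} (w : Fin (n + 1) → ℕ) (hw : ∑ v, w v = d + 1) :
    Fintype.card (GainElement w) = (n + 2).choose 2 + d * n := by
  rw [Fintype.card_option, Fintype.card_sigma]
  simp only [Fintype.card_fin]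
  rw [Finset.sum_add_distrib, sum_weight_orientedEdge, hw, Finset.sum_const, Finset.card_univ,
    smul_eq_mul, mul_one]
  have h1 := two_mul_card_orientedEdge n
  have h2 : (n + 2).choose 2 * 2 = (n + 2) * (n + 1) := by
    rw [Nat.choose_two_right]
    exact Nat.div_mul_cancel (by simpa using (Nat.even_mul_pred_self (n + 2)).two_dvd)
  linarith

section Polynomial

open Polynomial

/-- The generating function of a family of weights. -/
noncomputable def weightPolynomial {ι : Type*} [Fintype ι] (w : ι → ℕ) : ℤ[X] := ∑ v, X ^ w v

/-- The generating function of the weights of edges. -/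
noncomputable def edgeWeight {r : ℕ} (w : Fin r → ℕ) (p : OrientedEdge r) : ℕ := w p.1.1 + w p.1.2

theorem coeff_weightPolynomial {ι : Type*} [Fintype ι] (w : ι → ℕ) (k : ℕ) :
    (weightPolynomial w).coeff k = (Finset.univ.filter fun v => w v = k).card := by
  simp [weightPolynomial, coeff_X_pow, eq_comm]

theorem weightPolynomial_sq {r : ℕ} (w : Fin r → ℕ) :
    weightPolynomial w ^ 2 =
      2 * weightPolynomial (edgeWeight w) + expand ℤ 2 (weightPolynomial w) := by
  have h := sum_sum_eq_two_nsmul_add (fun i j => (X : ℤ[X]) ^ (w i + w j))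
    fun i j => by rw [add_comm]
  rw [nsmul_eq_mul] at h
  simp only [weightPolynomial, edgeWeight, sq, Finset.sum_mul_sum, ← pow_add, h, map_sum, map_pow,
    expand_X]
  simp [pow_add, mul_pow]

/-- A family of weights that takes the value `0` is determined by the sums of pairs. -/
theorem weightPolynomial_eq_of_edgeWeight {r : ℕ} {w w' : Fin r → ℕ} (hw : ∃ v, w v = 0)
    (hw' : ∃ v, w' v = 0)
    (h : weightPolynomial (edgeWeight w) = weightPolynomial (edgeWeight w')) :
    weightPolynomial w = weightPolynomial w' := by
  have hpos : ∀ u : Fin r → ℕ, (∃ v, u v = 0) → 1 ≤ (weightPolynomial u).coeff 0 := by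
    rintro u ⟨v, hv⟩
    rw [coeff_weightPolynomial]
    exact_mod_cast Finset.card_pos.2 ⟨v, by simp [hv]⟩
  set f := weightPolynomial w
  set g := weightPolynomial w'
  have hmul : (f - g) * (f + g) = expand ℤ 2 (f - g) := by
    have h1 := weightPolynomial_sq w
    have h2 := weightPolynomial_sq w'
    rw [map_sub]
    rw [h] at h1
    linear_combination h1 - h2
  rw [← sub_eq_zero]
  ext k
  rw [coeff_zero]
  induction k using Nat.strong_induction_on with
  | _ k ih =>
    have hk := congrArg (fun q => coeff q k) hmul
    simp only [coeff_mul] at hk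
    rw [Finset.sum_eq_single (k, 0), coeff_expand two_pos, coeff_add] at hk
    · have h1 := hpos w hw
      have h2 := hpos w' hw'
      rcases Nat.eq_zero_or_pos k with rfl | hk0
      · simp only [dvd_zero, if_true, Nat.zero_div] at hk
        have h3 : (f - g).coeff 0 * (f.coeff 0 + g.coeff 0 - 1) = 0 := by linear_combination hk
        exact (mul_eq_zero.1 h3).resolve_right fun e => by linarith
      · rw [ih (k / 2) (Nat.div_lt_self hk0 one_lt_two), ite_self] at hk
        exact (mul_eq_zero.1 hk).resolve_right fun e => by linarith
    · rintro ⟨i, j⟩ hij hne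
      rw [Finset.HasAntidiagonal.mem_antidiagonal] at hij
      rw [ih i, zero_mul]
      simp only [ne_eq, Prod.mk.injEq] at hne
      simp only at hij
      omega
    · simp

/-- Families of weights of the same size and sum agree if they agree above `1`. -/
theorem weightPolynomial_eq_of_coeff {ι : Type*} [Fintype ι] {w w' : ι → ℕ}
    (hs : ∑ v, w v = ∑ v, w' v)
    (h : ∀ k, 2 ≤ k → (weightPolynomial w).coeff k = (weightPolynomial w').coeff k) :
    weightPolynomial w = weightPolynomial w' := by
  rw [← sub_eq_zero]
  have hdeg : (weightPolynomial w - weightPolynomial w').natDegree ≤ 1 := by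
    rw [natDegree_le_iff_coeff_eq_zero]
    intro k hk
    rw [coeff_sub, h k hk, sub_self]
  obtain ⟨a, b, hab⟩ := exists_eq_X_add_C_of_natDegree_le_one hdeg
  have h1 := congrArg (fun q => eval 1 q) hab
  have h2 := congrArg (fun q => eval 1 (derivative q)) hab
  have hs' : ∑ v, (w v : ℤ) = ∑ v, (w' v : ℤ) := by exact_mod_cast hs
  simp only [weightPolynomial, eval_sub, eval_finsetSum, eval_pow, eval_X, one_pow, sub_self,
    eval_add, eval_mul, eval_C, mul_one] at h1
  have ha : a = 0 := by
    simpa [weightPolynomial, eval_finsetSum, derivative_X_pow, hs'] using h2.symm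
  subst ha
  rw [zero_add] at h1
  rw [hab, ← h1]
  simp

theorem map_univ_eq_of_weightPolynomial {ι : Type*} [Fintype ι] {w w' : ι → ℕ}
    (h : weightPolynomial w = weightPolynomial w') :
    Finset.univ.val.map w = Finset.univ.val.map w' := by
  ext k
  have hk := congrArg (fun q => coeff q k) h
  simp only [coeff_weightPolynomial, Nat.cast_inj] at hk
  simpa [Multiset.count_map, Finset.card_def, eq_comm] using hk

/-- Weights with the same sum that take the value `0` are determined by the line counts. -/
theorem map_univ_eq_of_longLineCount_eq {n : ℕ} {w w' : Fin (n + 1) → ℕ}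
    (hs : ∑ v, w v = ∑ v, w' v) (hw : ∃ v, w v = 0) (hw' : ∃ v, w' v = 0)
    (h : ∀ m, longLineCount (gainMatrix w) m = longLineCount (gainMatrix w') m) :
    Finset.univ.val.map w = Finset.univ.val.map w' := by
  refine map_univ_eq_of_weightPolynomial (weightPolynomial_eq_of_edgeWeight hw hw' ?_)
  refine weightPolynomial_eq_of_coeff ?_ fun k hk => ?_
  · simp only [edgeWeight, sum_weight_orientedEdge, hs]
  · have := h (k + 2)
    rw [GainElement.longLineCount_gainMatrix hk, GainElement.longLineCount_gainMatrix hk] at this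
    rw [coeff_weightPolynomial, coeff_weightPolynomial]
    exact_mod_cast this

end Polynomial

theorem exists_map_univ_eq {r : ℕ} {s : Multiset ℕ} (hs : s.card = r) :
    ∃ w : Fin r → ℕ, Finset.univ.val.map w = s := by
  subst hs
  obtain ⟨l, rfl⟩ := Quot.exists_rep s
  have h : Finset.univ.val.map l.get = (l : Multiset ℕ) := by rw [Fin.univ_val_map, List.ofFn_get]
  exact ⟨l.get, h⟩

/-- The partition of `Δ` with the single part `Δ`, and those obtained from a partition of `Δ - 1`
by adding a part `1`. -/
def extendedParts (Δ : ℕ) : Option (Nat.Partition (Δ - 1)) → Multiset ℕ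
  | none => {Δ}
  | some p => 1 ::ₘ p.parts

theorem extendedParts_injective {Δ : ℕ} (hΔ : 2 ≤ Δ) : Function.Injective (extendedParts Δ) := by
  have h : ∀ p : Nat.Partition (Δ - 1), {Δ} ≠ 1 ::ₘ p.parts := fun p e => by
    have : 1 ∈ ({Δ} : Multiset ℕ) := e ▸ Multiset.mem_cons_self 1 _
    rw [Multiset.mem_singleton] at this
    omega
  rintro (_ | p) (_ | q) hpq
  · rfl
  · exact absurd hpq (h q)
  · exact absurd hpq.symm (h p)
  · rw [Nat.Partition.ext ((Multiset.cons_inj_right 1).1 hpq)]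

theorem sum_extendedParts {Δ : ℕ} (hΔ : 2 ≤ Δ) (p) : (extendedParts Δ p).sum = Δ := by
  rcases p with _ | p
  · simp [extendedParts]
  · simp only [extendedParts, Multiset.sum_cons, p.parts_sum]
    omega

theorem pos_of_mem_extendedParts {Δ : ℕ} (hΔ : 2 ≤ Δ) {p} {k : ℕ} (hk : k ∈ extendedParts Δ p) :
    0 < k := by
  rcases p with _ | p
  · rw [extendedParts, Multiset.mem_singleton] at hk
    omega
  · rcases Multiset.mem_cons.1 hk with rfl | hk
    · exact one_pos
    · exact p.parts_pos hk

theorem exists_weights {Δ n : ℕ} (hΔ : 2 ≤ Δ) (hn : Δ ≤ n) (p : Option (Nat.Partition (Δ - 1))) :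
    ∃ w : Fin (n + 1) → ℕ, ∑ v, w v = Δ ∧ (∃ v, w v = 0) ∧
      (Finset.univ.val.map w).filter (0 < ·) = extendedParts Δ p := by
  have hcard : (extendedParts Δ p).card ≤ Δ := by
    have h := Multiset.card_nsmul_le_sum (s := extendedParts Δ p) (a := 1)
      fun k hk => pos_of_mem_extendedParts hΔ hk
    rwa [sum_extendedParts hΔ, smul_eq_mul, mul_one] at h
  obtain ⟨w, hw⟩ := exists_map_univ_eq (r := n + 1)
    (s := extendedParts Δ p + Multiset.replicate (n + 1 - (extendedParts Δ p).card) 0) (by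
      rw [Multiset.card_add, Multiset.card_replicate]
      omega)
  refine ⟨w, ?_, ?_, ?_⟩
  · rw [Finset.sum, hw]
    simp [sum_extendedParts hΔ]
  · have : 0 ∈ Finset.univ.val.map w := by
      rw [hw, Multiset.mem_add, Multiset.mem_replicate]
      exact Or.inr ⟨by omega, rfl⟩
    obtain ⟨v, -, hv⟩ := Multiset.mem_map.1 this
    exact ⟨v, hv⟩
  · rw [hw, Multiset.filter_add, Multiset.filter_eq_self.2 fun k => pos_of_mem_extendedParts hΔ,
      Multiset.filter_eq_nil.2, add_zero]
    intro k hk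
    simp [Multiset.eq_of_mem_replicate hk]

theorem rank_gainMatrix {n m : ℕ} {w : Fin (n + 1) → ℕ} (e : Fin m ≃ GainElement w) :
    (((gainMatrix w).submatrix id e).map (fun z : ℤ => (z : ℚ))).rank = n + 1 := by
  have hli : LinearIndependent ℚ
      (((gainMatrix w).submatrix id e).map (fun z : ℤ => (z : ℚ))).row := by
    rw [← Matrix.vecMul_injective_iff]
    refine (injective_iff_map_eq_zero (Matrix.vecMulLinear _)).2 fun y hy => ?_
    have hy' : ∀ x, ∑ k, y k * (gainMatrix w k x : ℚ) = 0 := fun x => by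
      simpa [Matrix.vecMul, dotProduct] using congrFun hy (e.symm x)
    have h0 : y 0 = 0 := by
      simpa [gainMatrix, Fin.sum_univ_succ, Fin.succ_ne_zero, GainElement.gain,
        GainElement.incidence] using hy' none
    ext k
    refine Fin.cases h0 (fun k => ?_) k
    simpa [gainMatrix, Fin.sum_univ_succ, Fin.succ_ne_zero, h0, GainElement.incidence] using
      hy' (some ⟨⟨(0, k.succ), Fin.succ_pos k⟩, 0⟩)
  simpa using hli.rank_matrix

theorem gainMatrix_not_intParallel {n : ℕ} {w : Fin (n + 1) → ℕ} {a b : GainElement w}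
    (hab : a ≠ b) :
    ¬ IntParallel (fun k => gainMatrix w k a) (fun k => gainMatrix w k b) := by
  rw [IntParallel, not_not, LinearIndependent.pair_iff]
  exact fun s t h => GainElement.pair_independent hab fun k => by simpa using congrFun h k

theorem gainMatrix_col_ne_zero {n : ℕ} {w : Fin (n + 1) → ℕ} (hn : 0 < n) (a : GainElement w) :
    (fun k => gainMatrix w k a) ≠ 0 := by
  intro h
  have : Nontrivial (GainElement w) :=
    ⟨none, some ⟨⟨(0, ⟨1, by omega⟩), by simp [Fin.lt_def]⟩, 0⟩, by simp⟩
  obtain ⟨b, hb⟩ := exists_ne a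
  have := (GainElement.pair_independent (K := ℚ) (s := 1) (t := 0) hb.symm fun k => by
    have := congrFun h k
    simp only [Pi.zero_apply] at this
    simp [this]).1
  norm_num at this

theorem exponentially_many_extremal_matroids (Δ r : ℕ) (hΔ : 2 ≤ Δ) (hr : Δ + 1 ≤ r) :
    ∃ A : Fin (Fintype.card (Nat.Partition (Δ - 1)) + 1) →
        Matrix (Fin r) (Fin ((r + 1).choose 2 + (Δ - 1) * (r - 1))) ℤ,
      (∀ i,
        ((A i).map (fun z : ℤ => (z : ℚ))).rank = r ∧
        DeltaModular (A i) (Δ : ℤ) ∧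
        (∀ j, (fun k => A i k j) ≠ 0) ∧
        (∀ j j', j ≠ j' →
          ¬ IntParallel (fun k => A i k j) (fun k => A i k j'))) ∧
      (∀ i j, i ≠ j → ¬ MatroidIso (A i) (A j)) := by
  obtain ⟨n, rfl⟩ : ∃ n, r = n + 1 := ⟨r - 1, by omega⟩
  choose w hsum hzero hparts using exists_weights hΔ (show Δ ≤ n by omega)
  have hcard : Fintype.card (Fin (Fintype.card (Nat.Partition (Δ - 1)) + 1)) =
      Fintype.card (Option (Nat.Partition (Δ - 1))) := by simp
  let o := Fintype.equivOfCardEq hcard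
  have he : ∀ p, Fintype.card (Fin ((n + 1 + 1).choose 2 + (Δ - 1) * (n + 1 - 1))) =
      Fintype.card (GainElement (w p)) := fun p => by
    rw [Fintype.card_fin, card_gainElement (w p) (d := Δ - 1) (by rw [hsum]; omega)]
    simp
  let e := fun p => Fintype.equivOfCardEq (he p)
  refine ⟨fun i => (gainMatrix (w (o i))).submatrix id (e (o i)), fun i => ⟨?_, ?_, ?_, ?_⟩, ?_⟩
  · exact rank_gainMatrix _
  · intro f _
    have := GainElement.abs_det_gainMatrix_le (fun t => e (o i) (f t))
      (by rw [hsum]; omega)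
    rw [← Nat.cast_sum, hsum] at this
    exact this
  · exact fun j => gainMatrix_col_ne_zero (by omega) _
  · exact fun j j' hj => gainMatrix_not_intParallel ((e (o i)).injective.ne hj)
  · intro i j hij hiso
    refine hij (o.injective (extendedParts_injective hΔ ?_))
    rw [← hparts, ← hparts, map_univ_eq_of_longLineCount_eq ((hsum _).trans (hsum _).symm)
      (hzero _) (hzero _) fun m => ?_]
    rw [← (matroidIso_submatrix _ (e (o i))).longLineCount_eq,
      ← (matroidIso_submatrix _ (e (o j))).longLineCount_eq]
    exact hiso.longLineCount_eq m
end

section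
/- Let a_1, a_2, a_3, a_4, x, y ∈ ℝ with x ≠ 0 and y ≠ 0. Let A be the 4×12 real matrix whose columns are the four standard unit vectors e_1, …, e_4, the six vectors e_i − e_j for 1 ≤ i < j ≤ 4, and the two columns (a_1, a_3, x, 0)ᵀ and (a_2, a_4, 0, y)ᵀ. Let s_1, s_3 ∈ {0, x} be such that s_1 and s_3 are not both equal to x, and let s_2, s_4 ∈ {0, y} be such that s_2 and s_4 are not both equal to y. Then the 2×2 matrix B with rows (a_1 + s_1, a_2 + s_2) and (a_3 + s_3, a_4 + s_4) satisfies |det(B)| ≤ max{|det(C)| : C is a square submatrix of A (of any size)}. -/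
/-- The determinant of a block matrix whose lower blocks are diagonal. -/
theorem det_fin_four_of_zeros {R : Type*} [CommRing R] (a₁ a₂ a₃ a₄ x y p₀ p₁ p₂ q₀ q₁ q₃ : R) :
    !![a₁, a₂, p₀, q₀; a₃, a₄, p₁, q₁; x, 0, p₂, 0; 0, y, 0, q₃].det =
      (p₂ * a₁ - p₀ * x) * (q₃ * a₄ - q₁ * y) - (q₃ * a₂ - q₀ * y) * (p₂ * a₃ - p₁ * x) := by
  simp [Matrix.det_succ_row_zero, Fin.sum_univ_succ, Fin.succAbove]
  ring

theorem perturb_matrix (a₁ a₂ a₃ a₄ x y : ℝ) (hx : x ≠ 0) (hy : y ≠ 0)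
    (A : Matrix (Fin 4) (Fin 12) ℝ)
    (hA : A = Matrix.of fun i j =>
      (![![(1:ℝ),0,0,0], ![0,1,0,0], ![0,0,1,0], ![0,0,0,1],
         ![1,-1,0,0], ![1,0,-1,0], ![1,0,0,-1],
         ![0,1,-1,0], ![0,1,0,-1], ![0,0,1,-1],
         ![a₁,a₃,x,0], ![a₂,a₄,0,y]] : Fin 12 → Fin 4 → ℝ) j i)
    (s₁ s₂ s₃ s₄ : ℝ)
    (hs₁ : s₁ = 0 ∨ s₁ = x) (hs₃ : s₃ = 0 ∨ s₃ = x)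
    (hs₁₃ : ¬ (s₁ = x ∧ s₃ = x))
    (hs₂ : s₂ = 0 ∨ s₂ = y) (hs₄ : s₄ = 0 ∨ s₄ = y)
    (hs₂₄ : ¬ (s₂ = y ∧ s₄ = y))
    (B : Matrix (Fin 2) (Fin 2) ℝ)
    (hB : B = !![a₁ + s₁, a₂ + s₂; a₃ + s₃, a₄ + s₄]) :
    ∃ (k : ℕ) (g : Fin k → Fin 4) (f : Fin k → Fin 12),
      1 ≤ k ∧ Function.Injective g ∧ Function.Injective f ∧
      |B.det| ≤ |(A.submatrix g f).det| := by
  have hc : ∃ c ∈ ({2, 5, 7} : Finset (Fin 12)), |A 2 c| = 1 ∧ A 3 c = 0 ∧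
      A 0 c * x = -(s₁ * A 2 c) ∧ A 1 c * x = -(s₃ * A 2 c) := by
    rcases hs₁ with h₁ | h₁ <;> rcases hs₃ with h₃ | h₃
    · exact ⟨2, by decide, by simp [hA, h₁, h₃]⟩
    · exact ⟨7, by decide, by simp [hA, h₁, h₃]⟩
    · exact ⟨5, by decide, by simp [hA, h₁, h₃]⟩
    · exact absurd ⟨h₁, h₃⟩ hs₁₃
  have hd : ∃ d ∈ ({3, 6, 8} : Finset (Fin 12)), |A 3 d| = 1 ∧ A 2 d = 0 ∧
      A 0 d * y = -(s₂ * A 3 d) ∧ A 1 d * y = -(s₄ * A 3 d) := by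
    rcases hs₂ with h₂ | h₂ <;> rcases hs₄ with h₄ | h₄
    · exact ⟨3, by decide, by simp [hA, h₂, h₄]⟩
    · exact ⟨8, by decide, by simp [hA, h₂, h₄]⟩
    · exact ⟨6, by decide, by simp [hA, h₂, h₄]⟩
    · exact absurd ⟨h₂, h₄⟩ hs₂₄
  obtain ⟨c, hc, hc₂, hc₃, hc₀, hc₁⟩ := hc
  obtain ⟨d, hd, hd₃, hd₂, hd₀, hd₁⟩ := hd
  have hinj : ∀ c ∈ ({2, 5, 7} : Finset (Fin 12)), ∀ d ∈ ({3, 6, 8} : Finset (Fin 12)),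
      Function.Injective ![10, 11, c, d] := by decide
  refine ⟨4, id, ![10, 11, c, d], by norm_num, Function.injective_id, hinj c hc d hd, ?_⟩
  have hsub : A.submatrix id ![10, 11, c, d] =
      !![a₁, a₂, A 0 c, A 0 d; a₃, a₄, A 1 c, A 1 d; x, 0, A 2 c, 0; 0, y, 0, A 3 d] := by
    ext i j
    fin_cases j
    · fin_cases i <;> simp [hA]
    · fin_cases i <;> simp [hA]
    · fin_cases i <;> simp [hc₃]
    · fin_cases i <;> simp [hd₂]
  have hdet : (A.submatrix id ![10, 11, c, d]).det = A 2 c * A 3 d * B.det := by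
    rw [hsub, det_fin_four_of_zeros, hB, Matrix.det_fin_two_of]
    linear_combination (-(A 3 d * a₄ - A 1 d * y)) * hc₀ + (A 3 d * a₂ - A 0 d * y) * hc₁
      + A 2 c * (a₃ + s₃) * hd₀ - A 2 c * (a₁ + s₁) * hd₁
  rw [hdet, abs_mul, abs_mul, hc₂, hd₃, one_mul, one_mul]
end

section
/- Let r ≥ 3 be an integer and let a, b ∈ ℤ^{r−1} with a ≠ b, Σ a_i = −1 and Σ b_i = −1. Let A be the (r+1) × (binom(r+1,2)+2) integer matrix whose columns are the columns of D_{r+1} together with the two columns (a, 1, 0)ᵀ and (b, 0, 1)ᵀ (that is, a respectively b in the first r−1 coordinates, followed by the pair (1,0) respectively (0,1)); note the rows of A sum to the zero vector. Suppose the columns of A are pairwise non-parallel and every r×r submatrix of A has determinant of absolute value at most 3. Then, for (u, v) = (a, b) or (u, v) = (b, a), the multiset {(u_i, v_i) : i ∈ [r−1], (u_i, v_i) ≠ (0, 0)} equals the multiset of rows of one of the following eight matrices (each row written as a pair): {(−3,−2),(2,1)}; {(−2,1),(1,−2)}; {(−2,1),(1,−1),(0,−1)}; {(−2,−1),(1,1),(0,−1)};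 {(−2,−1),(2,1),(−1,−1)}; {(−1,−1),(−1,1),(1,−1)}; {(−1,−1),(1,1),(−1,0),(0,−1)}; {(−1,1),(1,−1),(−1,0),(0,−1)}. -/
/-- The index set for the columns of `D_r`: pairs `(i, j)` with `i < j`. -/
abbrev PairIdx (r : ℕ) := {p : Fin r × Fin r // p.1 < p.2}

/-- The integer matrix `D_r` whose columns are `e_i - e_j` for `i < j`. -/
def Dmat (r : ℕ) : Matrix (Fin r) (PairIdx r) ℤ :=
  Matrix.of fun i p => if i = p.val.1 then 1 else if i = p.val.2 then -1 else 0

/-- The multiset of pairs `(u i, v i)` over those indices where `(u i, v i) ≠ (0, 0)`. -/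
def pairMultiset {m : ℕ} (u v : Fin m → ℤ) : Multiset (ℤ × ℤ) :=
  Multiset.map (fun i => (u i, v i))
    (Finset.filter (fun i => ¬ (u i = 0 ∧ v i = 0)) Finset.univ).val

/-- Let each column of `M`, apart from the columns `x k`, be up to sign the edge from `j` to its
root `ρ j` in a star forest with roots `z` and `x k`. Then up to sign the determinant of `M` is that
of the matrix of sums of the columns `x l` over the stars with root `x k`. -/
theorem abs_det_star_forest {J κ : Type*} [Fintype J] [DecidableEq J] [Fintype κ]
    [DecidableEq κ] (ρ : J → J) (hρ : ∀ j, ρ (ρ j) = ρ j) (z : J)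
    (x : κ → J) (hx : Function.Injective x) (hxz : ∀ k, x k ≠ z) (hxρ : ∀ k, ρ (x k) = x k)
    (hroot : ∀ j, ρ j = j → j = z ∨ ∃ k, x k = j)
    (M : Matrix {j // j ≠ z} {j // j ≠ z} ℤ) (s : J → ℤ) (hs : ∀ j, |s j| = 1)
    (hM : ∀ i j : {j // j ≠ z}, ρ j ≠ j →
      M i j = s j * ((if (i : J) = j then 1 else 0) - if (i : J) = ρ j then 1 else 0)) :
    |M.det| = |(Matrix.of fun k l : κ =>
      ∑ j : {j // j ≠ z}, if ρ j = x k then M j ⟨x l, hxz l⟩ else 0).det| := by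
  let U : Matrix {j // j ≠ z} {j // j ≠ z} ℤ :=
    Matrix.of fun i j => if (i : J) = j ∨ (i : J) = ρ j then 1 else 0
  let F : Matrix {j // j ≠ z} {j // j ≠ z} ℤ :=
    Matrix.of fun i j => if (i : J) = j then 1 else if (i : J) = ρ j then -1 else 0
  let s' : {j // j ≠ z} → ℤ := fun j => if ρ j = j then 1 else s j
  have hs' : ∀ j, |s' j| = 1 := fun j => by
    by_cases h : ρ j = j <;> simp [s', h, hs]
  have hcol : ∀ (i j : {j // j ≠ z}), ρ j ≠ j →
      ∑ t : {j // j ≠ z}, U i t * ((if (t : J) = j then 1 else 0) - if (t : J) = ρ j then 1 else 0)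
        = if i = j then 1 else 0 := by
    intro i j hj
    have h1 : ∑ t : {j // j ≠ z}, U i t * (if (t : J) = j then 1 else 0) = U i j := by
      simp [Subtype.val_inj]
    have h2 : ∑ t : {j // j ≠ z}, U i t * (if (t : J) = ρ j then 1 else 0) =
        if (i : J) = ρ j then 1 else 0 := by
      by_cases hjz : ρ j = z
      · have : ∀ t : {j // j ≠ z}, (t : J) ≠ ρ j := fun t => by rw [hjz]; exact t.2
        simp [this]
      · rw [Finset.sum_eq_single ⟨ρ j, hjz⟩]
        · simp [U, hρ]
        · intro t _ ht
          have : (t : J) ≠ ρ j := fun h => ht (Subtype.ext h)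
          simp [this]
        · simp
    simp only [mul_sub, Finset.sum_sub_distrib, h1, h2]
    simp only [U, Matrix.of_apply]
    by_cases hij : i = j
    · subst hij
      simp [Ne.symm hj]
    · simp [hij, Subtype.val_inj]
  have hUF : U * F = 1 := by
    ext i j
    rw [Matrix.mul_apply, Matrix.one_apply]
    by_cases hj : ρ j = j
    · have : ∀ t, F t j = if t = j then 1 else 0 := fun t => by
        by_cases ht : t = j <;> simp [F, hj, ht, Subtype.val_inj]
      simp [this, U, hj, Subtype.val_inj]
    · rw [← hcol i j hj]
      refine Finset.sum_congr rfl fun t _ => ?_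
      congr 1
      simp only [F, Matrix.of_apply]
      split_ifs with h1 h2 <;> simp_all
  have hU : |U.det| = 1 := by
    have h : U.det * F.det = 1 := by rw [← Matrix.det_mul, hUF, Matrix.det_one]
    exact Int.isUnit_iff_abs_eq.1 (IsUnit.of_mul_eq_one _ h)
  let P : Matrix {j // j ≠ z} κ ℤ := Matrix.of fun i l =>
    (U * M) i ⟨x l, hxz l⟩ - if (i : J) = x l then 1 else 0
  let Q : Matrix κ {j // j ≠ z} ℤ := Matrix.of fun k j => if (j : J) = x k then 1 else 0
  have hUM : U * M * Matrix.diagonal s' = 1 + P * Q := by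
    ext i j
    rw [Matrix.mul_diagonal, Matrix.add_apply, Matrix.one_apply]
    by_cases hj : ρ j = j
    · obtain ⟨k, hk⟩ := (hroot j hj).resolve_left j.2
      obtain rfl : j = ⟨x k, hxz k⟩ := Subtype.ext hk.symm
      have : (P * Q) i ⟨x k, hxz k⟩ = P i k := by
        simp [Matrix.mul_apply, Q, hx.eq_iff]
      rw [this]
      simp [P, s', hj, Subtype.ext_iff]
    · have : (P * Q) i j = 0 := by
        rw [Matrix.mul_apply]
        refine Finset.sum_eq_zero fun k _ => ?_
        have : (j : J) ≠ x k := fun h => hj (by rw [h, hxρ])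
        simp [Q, this]
      rw [this, add_zero, ← hcol i j hj, Matrix.mul_apply, Finset.sum_mul]
      refine Finset.sum_congr rfl fun t _ => ?_
      rw [hM t j hj]
      have hsq : s j * s j = 1 := by rw [← abs_mul_abs_self, hs, mul_one]
      simp only [s', if_neg hj]
      linear_combination
        (U i t * ((if (t : J) = j then 1 else 0) - if (t : J) = ρ j then 1 else 0)) * hsq
  have hdet : |M.det| = |(1 + P * Q).det| := by
    rw [← hUM, Matrix.det_mul, Matrix.det_mul, Matrix.det_diagonal, abs_mul, abs_mul, hU,
      Finset.abs_prod, Finset.prod_congr rfl fun j _ => hs' j]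
    simp
  rw [hdet, Matrix.det_one_add_mul_comm]
  congr 2
  ext k l
  have hQP : (Q * P) k l = P ⟨x k, hxz k⟩ l := by
    rw [Matrix.mul_apply, Finset.sum_eq_single ⟨x k, hxz k⟩]
    · simp [Q]
    · intro j _ hj
      have : (j : J) ≠ x k := fun h => hj (Subtype.ext h)
      simp [Q, this]
    · simp
  have hUM : (U * M) ⟨x k, hxz k⟩ ⟨x l, hxz l⟩ =
      ∑ j : {j // j ≠ z}, if ρ j = x k then M j ⟨x l, hxz l⟩ else 0 := by
    rw [Matrix.mul_apply]
    refine Finset.sum_congr rfl fun j _ => ?_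
    have : (x k = j ∨ x k = ρ j) ↔ ρ j = x k := 
      ⟨fun h => h.elim (fun h => by rw [← h, hxρ]) Eq.symm, fun h => Or.inr h.symm⟩
    simp [U, this]
  rw [Matrix.add_apply, Matrix.one_apply, hQP, Matrix.of_apply, ← hUM]
  simp [P, hx.eq_iff]

/-- Minors of a matrix extending `D_{r+1}` by two columns, computed along a star forest. -/
theorem abs_det_sum_fibers_le {r : ℕ} {κ : Type*} [Fintype κ] [DecidableEq κ]
    (A : Matrix (Fin (r + 1)) (PairIdx (r + 1) ⊕ Bool) ℤ)
    (hA : ∀ i p, A i (Sum.inl p) = Dmat (r + 1) i p)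
    (hmod : ∀ (g : Fin r → Fin (r + 1)) (f : Fin r → PairIdx (r + 1) ⊕ Bool),
      Function.Injective g → Function.Injective f → |(A.submatrix g f).det| ≤ 3)
    (ρ : Fin (r + 1) → Fin (r + 1)) (hρ : ∀ j, ρ (ρ j) = ρ j)
    (z : Fin (r + 1)) (hz : ρ z = z) (x : κ → Fin (r + 1)) (hx : Function.Injective x)
    (hxz : ∀ k, x k ≠ z) (hxρ : ∀ k, ρ (x k) = x k)
    (hroot : ∀ j, ρ j = j → j = z ∨ ∃ k, x k = j) (c : κ → Bool) :
    |(Matrix.of fun k l : κ => ∑ j, if ρ j = x k then A j (Sum.inr (c l)) else 0).det| ≤ 3 := by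
  let s : Fin (r + 1) → ℤ := fun j => if j < ρ j then 1 else -1
  have hcol : ∀ j : {j // j ≠ z}, ∃ q : PairIdx (r + 1) ⊕ Bool,
      (ρ j ≠ j → ∀ i, A i q =
        s j * ((if i = (j : Fin (r + 1)) then 1 else 0) - if i = ρ j then 1 else 0)) ∧
      ∀ k, x k = j → q = Sum.inr (c k) := by
    intro j
    by_cases hj : ρ j = j
    · obtain ⟨k, hk⟩ := (hroot j hj).resolve_left j.2
      exact ⟨Sum.inr (c k), fun h => absurd hj h, fun l hl => by rw [hx (hl.trans hk.symm)]⟩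
    · have hno : ∀ k, x k ≠ j := fun k hk => hj (hk ▸ hxρ k)
      rcases lt_or_gt_of_ne hj with h | h
      · refine ⟨Sum.inl ⟨(ρ j, j), h⟩, fun _ i => ?_, fun k hk => absurd hk (hno k)⟩
        simp only [hA, Dmat, Matrix.of_apply, s, not_lt_of_gt h, if_false]
        split_ifs with h1 h2 <;> first | exact absurd (h1.symm.trans h2) hj | norm_num
      · refine ⟨Sum.inl ⟨(j, ρ j), h⟩, fun _ i => ?_, fun k hk => absurd hk (hno k)⟩
        simp only [hA, Dmat, Matrix.of_apply, s, h, if_true]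
        split_ifs <;> simp_all
  choose q hq hqx using hcol
  let M : Matrix {j // j ≠ z} {j // j ≠ z} ℤ := A.submatrix Subtype.val q
  have hM : |M.det| ≤ 3 := by
    let e := finSuccAboveEquiv z
    have hdet : M.det = (A.submatrix (fun i => (e i : Fin (r + 1))) (fun i => q (e i))).det := by
      rw [← Matrix.det_submatrix_equiv_self e M]
      rfl
    rw [hdet]
    by_cases hinj : Function.Injective fun i => q (e i)
    · exact hmod _ _ (Subtype.val_injective.comp e.injective) hinj
    · obtain ⟨i, j, hij, hne⟩ : ∃ i j, q (e i) = q (e j) ∧ i ≠ j := by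
        simpa [Function.Injective] using hinj
      rw [Matrix.det_zero_of_column_eq hne fun k => by simp [hij]]
      simp
  rw [abs_det_star_forest ρ hρ z x hx hxz hxρ hroot M s
    (fun j => by by_cases h : j < ρ j <;> simp [s, h]) (fun i j hj => hq j hj i)] at hM
  convert hM using 4
  ext k l
  have h := hqx ⟨x l, hxz l⟩ l rfl
  simp only [M, Matrix.submatrix_apply, h]
  rw [← Finset.sum_subtype (Finset.univ.filter (· ≠ z)) (by simp)
    (fun j => if ρ j = x k then A j (Sum.inr (c l)) else 0)]
  refine (Finset.sum_subset (Finset.filter_subset _ _) fun j _ hj => ?_).symm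
  obtain rfl : j = z := by simpa using hj
  rw [hz, if_neg (hxz k).symm]

/-- Two disjoint sets of rows give a bounded `2 × 2` determinant of row sums. -/
theorem abs_det_sums_le {r : ℕ}
    (A : Matrix (Fin (r + 1)) (PairIdx (r + 1) ⊕ Bool) ℤ)
    (hA : ∀ i p, A i (Sum.inl p) = Dmat (r + 1) i p)
    (hmod : ∀ (g : Fin r → Fin (r + 1)) (f : Fin r → PairIdx (r + 1) ⊕ Bool),
      Function.Injective g → Function.Injective f → |(A.submatrix g f).det| ≤ 3)
    (u v : Fin (r + 1) → ℤ) (hu : ∀ i, A i (Sum.inr false) = u i)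
    (hv : ∀ i, A i (Sum.inr true) = v i)
    (hu0 : ∑ i, u i = 0) (hv0 : ∑ i, v i = 0)
    (X Y : Finset (Fin (r + 1))) (hXY : Disjoint X Y) :
    |(∑ i ∈ X, u i) * (∑ i ∈ Y, v i) - (∑ i ∈ Y, u i) * (∑ i ∈ X, v i)| ≤ 3 := by
  rcases X.eq_empty_or_nonempty with rfl | ⟨x, hx⟩
  · simp
  rcases Y.eq_empty_or_nonempty with rfl | ⟨y, hy⟩
  · simp
  by_cases hZ : ∃ z, z ∉ X ∧ z ∉ Y
  · obtain ⟨z, hzX, hzY⟩ := hZ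
    have hne : ∀ {i}, i ∈ Y → i ∉ X := fun hi hi' => Finset.disjoint_left.1 hXY hi' hi
    have hyX := hne hy
    have hxy : x ≠ y := fun h => hyX (h ▸ hx)
    have hxz : x ≠ z := fun h => hzX (h ▸ hx)
    have hyz : y ≠ z := fun h => hzY (h ▸ hy)
    have h := abs_det_sum_fibers_le A hA hmod
      (fun i => if i ∈ X then x else if i ∈ Y then y else z)
      (by intro j; by_cases h1 : j ∈ X <;> by_cases h2 : j ∈ Y <;> simp [*]) z (by simp [*])
      ![x, y] (by intro i j; fin_cases i <;> fin_cases j <;> simp [hxy, hxy.symm])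
      (by intro i; fin_cases i <;> simp [*]) (by intro i; fin_cases i <;> simp [*])
      (by
        intro j hj
        by_cases h1 : j ∈ X
        · exact Or.inr ⟨0, by simpa [h1] using hj⟩
        · by_cases h2 : j ∈ Y
          · exact Or.inr ⟨1, by simpa [h1, h2] using hj⟩
          · exact Or.inl (by simpa [h1, h2] using hj.symm))
      ![false, true]
    have hfx : ∀ i, (if i ∈ X then x else if i ∈ Y then y else z) = x ↔ i ∈ X := fun i => by
      by_cases h1 : i ∈ X <;> by_cases h2 : i ∈ Y <;> simp [h1, h2, hxy.symm, hxz.symm]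
    have hfy : ∀ i, (if i ∈ X then x else if i ∈ Y then y else z) = y ↔ i ∈ Y := fun i => by
      by_cases h2 : i ∈ Y
      · simp [h2, hne h2]
      · by_cases h1 : i ∈ X <;> simp [h1, h2, hxy, hyz.symm]
    rw [Matrix.det_fin_two] at h
    simp only [Matrix.of_apply, Matrix.cons_val_zero, Matrix.cons_val_one, hfx, hfy, hu, hv,
      Finset.sum_ite_mem, Finset.univ_inter] at h
    rwa [mul_comm (∑ i ∈ Y, u i)]
  · have hY : Y = Xᶜ := by
      ext i
      rw [Finset.mem_compl]
      exact ⟨fun h h' => Finset.disjoint_left.1 hXY h' h, fun h => by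
        by_contra h'
        exact hZ ⟨i, h, h'⟩⟩
    have h1 := Finset.sum_add_sum_compl X u
    have h2 := Finset.sum_add_sum_compl X v
    rw [← hY] at h1 h2
    rw [show (∑ i ∈ X, u i) * (∑ i ∈ Y, v i) - (∑ i ∈ Y, u i) * (∑ i ∈ X, v i) = 0 by
      linear_combination (∑ i ∈ X, u i) * (h2 + hv0) - (∑ i ∈ X, v i) * (h1 + hu0)]
    simp

/-- A set of rows gives bounded row sums in each additional column. -/
theorem abs_sum_le {r : ℕ}
    (A : Matrix (Fin (r + 1)) (PairIdx (r + 1) ⊕ Bool) ℤ)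
    (hA : ∀ i p, A i (Sum.inl p) = Dmat (r + 1) i p)
    (hmod : ∀ (g : Fin r → Fin (r + 1)) (f : Fin r → PairIdx (r + 1) ⊕ Bool),
      Function.Injective g → Function.Injective f → |(A.submatrix g f).det| ≤ 3)
    (c : Bool) (hc : ∑ i, A i (Sum.inr c) = 0) (X : Finset (Fin (r + 1))) :
    |∑ i ∈ X, A i (Sum.inr c)| ≤ 3 := by
  rcases X.eq_empty_or_nonempty with rfl | ⟨x, hx⟩
  · simp
  by_cases hZ : ∃ z, z ∉ X
  · obtain ⟨z, hzX⟩ := hZ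
    have hxz : x ≠ z := fun h => hzX (h ▸ hx)
    have h := abs_det_sum_fibers_le A hA hmod (κ := Unit) (fun i => if i ∈ X then x else z)
      (by intro j; by_cases h1 : j ∈ X <;> simp [*]) z (by simp [*])
      (fun _ => x) (fun _ _ _ => rfl) (fun _ => hxz) (by simp [*])
      (by
        intro j hj
        by_cases h1 : j ∈ X
        · exact Or.inr ⟨(), by simpa [h1] using hj⟩
        · exact Or.inl (by simpa [h1] using hj.symm))
      (fun _ => c)
    have hfx : ∀ i, (if i ∈ X then x else z) = x ↔ i ∈ X := fun i => by
      by_cases h1 : i ∈ X <;> simp [h1, hxz.symm]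
    simpa only [Matrix.det_unique, Matrix.of_apply, hfx, Finset.sum_ite_mem,
      Finset.univ_inter] using h
  · obtain rfl : X = Finset.univ := Finset.eq_univ_iff_forall.2 (by simpa using hZ)
    simp [hc]

/-- The entries of `p` and its `2 × 2` determinant are bounded by `3` in absolute value. -/
def smallPair (p : (ℤ × ℤ) × (ℤ × ℤ)) : Bool :=
  Nat.ble p.1.1.natAbs 3 && Nat.ble p.1.2.natAbs 3 &&
    Nat.ble p.2.1.natAbs 3 && Nat.ble p.2.2.natAbs 3 &&
    Nat.ble (p.1.1 * p.2.2 - p.2.1 * p.1.2).natAbs 3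

/-- The pairs obtained by adding `w` to one of the two entries of a pair in `st`. -/
def addToPairs (w : ℤ × ℤ) (st : List ((ℤ × ℤ) × (ℤ × ℤ))) : List ((ℤ × ℤ) × (ℤ × ℤ)) :=
  st.map (fun p => (p.1 + w, p.2)) ++ st.map (fun p => (p.1, p.2 + w))

/-- The eight exceptional configurations and their images under swapping coordinates, sorted. -/
def exceptionalLists : List (List (ℤ × ℤ)) :=
  [[(-3, -2), (2, 1)], [(-2, -3), (1, 2)], [(-2, -1), (-1, -1), (2, 1)],
    [(-2, -1), (0, -1), (1, 1)], [(-2, 1), (0, -1), (1, -1)], [(-2, 1), (1, -2)],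
    [(-1, -2), (-1, -1), (1, 2)], [(-1, -2), (-1, 0), (1, 1)],
    [(-1, -1), (-1, 0), (0, -1), (1, 1)], [(-1, -1), (-1, 1), (1, -1)],
    [(-1, 0), (-1, 1), (0, -1), (1, -1)], [(-1, 0), (-1, 1), (1, -2)]]

/-- Either `l` is exceptional, or it violates one of the side conditions: it has the wrong sum,
a coordinate with a single nonzero entry, or equal coordinates throughout. -/
def admissible (l : List (ℤ × ℤ)) : Bool :=
  decide (l.sum ≠ (-1, -1)) || l.countP (fun p => p.1 ≠ 0) == 1 ||
    l.countP (fun p => p.2 ≠ 0) == 1 || l.all (fun p => p.1 = p.2) ||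
    decide (l ∈ exceptionalLists)

/-- The vectors `v` of `cs` that keep all pairs small when added to the pairs of `st`. -/
def extending (st : List ((ℤ × ℤ) × (ℤ × ℤ))) (cs : List (ℤ × ℤ)) : List (ℤ × ℤ) :=
  cs.filter fun v => (addToPairs v st).all smallPair

/-- Checks that all extensions of `acc` by vectors of `cs` with small pairs are admissible,
where `st` consists of pairs of disjoint subsums of `acc`. -/
def search : ℕ → List (ℤ × ℤ) → List ((ℤ × ℤ) × (ℤ × ℤ)) → List (ℤ × ℤ) → Bool
  | 0, _, _, _ => false
  | _ + 1, [], _, acc => admissible acc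
  | n + 1, w :: cs, st, acc =>
    search n cs st acc &&
      search n (extending (addToPairs w st ++ st) (w :: cs)) (addToPairs w st ++ st) (w :: acc)

/-- The nonzero vectors with entries bounded by `3` in absolute value. -/
def candidates : List (ℤ × ℤ) :=
  (([3, 2, 1, 0, -1, -2, -3] : List ℤ).product [3, 2, 1, 0, -1, -2, -3]).filter (· ≠ (0, 0))

/-- The pairs of disjoint subsums of `(1, 0), (0, 1)`, up to swapping the two entries. -/
def initialPairs : List ((ℤ × ℤ) × (ℤ × ℤ)) :=
  [((1, 0), (0, 1)), ((1, 0), (0, 0)), ((0, 0), (0, 1)), ((1, 1), (0, 0)), ((0, 0), (0, 0))]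

theorem search_candidates :
    search 100 (extending initialPairs candidates) initialPairs [] = true := by
  decide +kernel

/-- The entries of `p` are sums over two disjoint parts of `T`. -/
def IsSubsumPair (T : Multiset (ℤ × ℤ)) (p : (ℤ × ℤ) × (ℤ × ℤ)) : Prop :=
  ∃ X Y : Multiset (ℤ × ℤ), X + Y ≤ T ∧ X.sum = p.1 ∧ Y.sum = p.2

theorem IsSubsumPair.mono {S T : Multiset (ℤ × ℤ)} {p : (ℤ × ℤ) × (ℤ × ℤ)} (h : S ≤ T) :
    IsSubsumPair S p → IsSubsumPair T p
  | ⟨X, Y, hXY, hX, hY⟩ => ⟨X, Y, hXY.trans h, hX, hY⟩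

theorem IsSubsumPair.of_mem_addToPairs {T : Multiset (ℤ × ℤ)} {w : ℤ × ℤ}
    {st : List ((ℤ × ℤ) × (ℤ × ℤ))} (hst : ∀ p ∈ st, IsSubsumPair T p)
    {p : (ℤ × ℤ) × (ℤ × ℤ)} (hp : p ∈ addToPairs w st) : IsSubsumPair (w ::ₘ T) p := by
  rcases List.mem_append.1 hp with hp | hp <;> obtain ⟨q, hq, rfl⟩ := List.mem_map.1 hp <;>
    obtain ⟨X, Y, hXY, hX, hY⟩ := hst q hq
  · exact ⟨w ::ₘ X, Y, by simpa using hXY, by simp [hX, add_comm], hY⟩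
  · exact ⟨X, w ::ₘ Y, by simpa using hXY, hX, by simp [hY, add_comm]⟩

theorem mem_extending {T U : Multiset (ℤ × ℤ)} {st : List ((ℤ × ℤ) × (ℤ × ℤ))}
    {cs : List (ℤ × ℤ)} (hst : ∀ p ∈ st, IsSubsumPair T p)
    (hsmall : ∀ p, IsSubsumPair U p → smallPair p = true) {v : ℤ × ℤ} (hv : v ∈ cs)
    (hle : v ::ₘ T ≤ U) : v ∈ extending st cs :=
  List.mem_filter.2 ⟨hv, List.all_eq_true.2 fun p hp =>
    hsmall p ((IsSubsumPair.of_mem_addToPairs hst hp).mono hle)⟩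

theorem exists_admissible_of_search {E : Multiset (ℤ × ℤ)} (n : ℕ) (cs : List (ℤ × ℤ))
    (st : List ((ℤ × ℤ) × (ℤ × ℤ))) (acc : List (ℤ × ℤ)) (M : Multiset (ℤ × ℤ))
    (hsearch : search n cs st acc = true) (hM : ∀ v ∈ M, v ∈ cs)
    (hst : ∀ p ∈ st, IsSubsumPair ((acc : Multiset (ℤ × ℤ)) + E) p)
    (hsmall : ∀ p, IsSubsumPair ((acc : Multiset (ℤ × ℤ)) + M + E) p → smallPair p = true) :
    ∃ l : List (ℤ × ℤ), (l : Multiset (ℤ × ℤ)) = acc + M ∧ admissible l = true := by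
  induction n generalizing cs st acc M with
  | zero => simp [search] at hsearch
  | succ n ih =>
    match cs with
    | [] =>
      obtain rfl : M = 0 := Multiset.eq_zero_of_forall_notMem fun v hv => by simpa using hM v hv
      exact ⟨acc, by simp, hsearch⟩
    | w :: cs =>
      rw [search, Bool.and_eq_true] at hsearch
      by_cases hw : w ∈ M
      · obtain ⟨N, rfl⟩ := Multiset.exists_cons_of_mem hw
        have hst' : ∀ p ∈ addToPairs w st ++ st,
            IsSubsumPair (((w :: acc : List (ℤ × ℤ)) : Multiset (ℤ × ℤ)) + E) p := by
          intro p hp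
          rw [← Multiset.cons_coe, Multiset.cons_add]
          rcases List.mem_append.1 hp with hp | hp
          · exact IsSubsumPair.of_mem_addToPairs hst hp
          · exact (hst p hp).mono (Multiset.le_cons_self _ _)
        have heq : ((w :: acc : List (ℤ × ℤ)) : Multiset (ℤ × ℤ)) + N = acc + w ::ₘ N := by
          rw [← Multiset.cons_coe, Multiset.cons_add, Multiset.add_cons]
        obtain ⟨l, hl, hl'⟩ := ih _ _ (w :: acc) N hsearch.2 (fun v hv =>
          mem_extending hst' hsmall (hM v (Multiset.mem_cons_of_mem hv)) (by
            obtain ⟨N', rfl⟩ := Multiset.exists_cons_of_mem hv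
            rw [← heq, Multiset.add_cons, Multiset.cons_add, Multiset.cons_le_cons_iff]
            exact add_le_add_left (Multiset.le_add_right _ _) _)) hst' (by rwa [heq])
        exact ⟨l, hl.trans heq, hl'⟩
      · refine ih cs st acc M hsearch.1 (fun v hv => ?_) hst hsmall
        rcases List.mem_cons.1 (hM v hv) with rfl | h
        · exact absurd hv hw
        · exact h

theorem exists_admissible {M : Multiset (ℤ × ℤ)} (h0 : (0, 0) ∉ M)
    (hsmall : ∀ p, IsSubsumPair (M + {(1, 0), (0, 1)}) p → smallPair p = true) :
    ∃ l : List (ℤ × ℤ), (l : Multiset (ℤ × ℤ)) = M ∧ admissible l = true := by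
  have hinit : ∀ p ∈ initialPairs, IsSubsumPair {(1, 0), (0, 1)} p := by
    intro p hp
    simp only [initialPairs, List.mem_cons, List.not_mem_nil, or_false] at hp
    rcases hp with rfl | rfl | rfl | rfl | rfl
    · exact ⟨{(1, 0)}, {(0, 1)}, by decide, rfl, rfl⟩
    · exact ⟨{(1, 0)}, 0, by decide, rfl, rfl⟩
    · exact ⟨0, {(0, 1)}, by decide, rfl, rfl⟩
    · exact ⟨{(1, 0), (0, 1)}, 0, by decide, rfl, rfl⟩
    · exact ⟨0, 0, by decide, rfl, rfl⟩
  have hcand : ∀ v ∈ M, v ∈ candidates := by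
    intro v hv
    have hv0 : v ≠ (0, 0) := fun h => h0 (h ▸ hv)
    have hs := hsmall (v, 0) ⟨{v}, 0, by
      simpa only [add_zero, Multiset.singleton_le] using Multiset.mem_add.2 (Or.inl hv),
      by simp, by simp⟩
    obtain ⟨x, y⟩ := v
    simp only [smallPair, Bool.and_eq_true, Nat.ble_eq] at hs
    simp only [candidates, List.mem_filter, List.product, List.mem_flatMap, List.mem_map,
      decide_eq_true_eq, List.mem_cons, List.not_mem_nil, or_false]
    refine ⟨⟨x, by omega, y, by omega, rfl⟩, by simpa using hv0⟩
  obtain ⟨l, hl, hadm⟩ := exists_admissible_of_search (E := {(1, 0), (0, 1)}) 100 _ initialPairs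
    [] M search_candidates (fun v hv => mem_extending hinit hsmall (hcand v hv) (by
      obtain ⟨N, rfl⟩ := Multiset.exists_cons_of_mem hv
      rw [Multiset.cons_add, Multiset.cons_le_cons_iff]
      exact Multiset.le_add_left _ _)) (by simpa using hinit) (by simpa using hsmall)
  exact ⟨l, by simpa using hl, hadm⟩

/-- Disjoint subsums of a family of vectors are realized by disjoint index sets. -/
theorem IsSubsumPair.exists_disjoint {ι : Type*} [Fintype ι] [DecidableEq ι] {f : ι → ℤ × ℤ}
    {p : (ℤ × ℤ) × (ℤ × ℤ)} (hp : IsSubsumPair (Finset.univ.val.map f) p) :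
    ∃ X Y : Finset ι, Disjoint X Y ∧ ∑ i ∈ X, f i = p.1 ∧ ∑ i ∈ Y, f i = p.2 := by
  obtain ⟨X, Y, hXY, hX, hY⟩ := hp
  have split : ∀ (S : Multiset (ℤ × ℤ)) (s : Finset ι), S ≤ s.val.map f →
      ∃ t ⊆ s, t.val.map f = S := by
    intro S
    induction S using Multiset.induction_on with
    | empty => exact fun s _ => ⟨∅, by simp, rfl⟩
    | cons a S ih =>
      intro s hs
      obtain ⟨i, hi, rfl⟩ := Multiset.mem_map.1 (Multiset.mem_of_le hs (Multiset.mem_cons_self a S))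
      rw [← Finset.insert_erase hi, Finset.insert_val_of_notMem (Finset.notMem_erase i s),
        Multiset.map_cons, Multiset.cons_le_cons_iff] at hs
      obtain ⟨t, hts, ht⟩ := ih _ hs
      have hit : i ∉ t := fun h => Finset.notMem_erase i s (hts h)
      refine ⟨insert i t, Finset.insert_subset hi (hts.trans (Finset.erase_subset i s)), ?_⟩
      rw [Finset.insert_val_of_notMem hit, Multiset.map_cons, ht]
  obtain ⟨t, -, ht⟩ := split X Finset.univ ((Multiset.le_add_right X Y).trans hXY)
  have htc : (Finset.univ : Finset ι).val = t.val + tᶜ.val := by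
    rw [← Finset.disjUnion_val _ _ disjoint_compl_right, Finset.disjUnion_eq_union,
      Finset.union_compl]
  rw [htc, Multiset.map_add, ht, add_le_add_iff_left] at hXY
  obtain ⟨u, hu, huY⟩ := split Y _ hXY
  refine ⟨t, u, disjoint_compl_right.mono_right hu, ?_, ?_⟩
  · rw [← hX, ← ht]; rfl
  · rw [← hY, ← huY]; rfl

/-- If the nonzero entry of `a` is unique, then it equals the sum of `a`. -/
theorem exists_eq_single_of_countP {m : ℕ} {u v : Fin m → ℤ} {g : ℤ × ℤ → ℤ} {a : Fin m → ℤ}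
    (hg : ∀ i, g (u i, v i) = a i) (ha : ∀ i, u i = 0 ∧ v i = 0 → a i = 0)
    (hcount : (pairMultiset u v).countP (fun p => g p ≠ 0) = 1) :
    ∃ i, a = Pi.single i (∑ j, a j) := by
  rw [pairMultiset, Multiset.countP_map, ← Finset.filter_val, Finset.filter_filter,
    Finset.card_val, Finset.card_eq_one] at hcount
  obtain ⟨i, hi⟩ := hcount
  have hmem : ∀ j, a j ≠ 0 → j = i := fun j hj => by
    rw [← Finset.mem_singleton, ← hi]
    exact Finset.mem_filter.2 ⟨Finset.mem_univ _, fun h => hj (ha j h), by rwa [hg]⟩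
  have hzero : ∀ j, j ≠ i → a j = 0 := fun j hj => by
    by_contra h
    exact hj (hmem j h)
  refine ⟨i, ?_⟩
  rw [Finset.sum_eq_single i (fun j _ hj => hzero j hj) (by simp)]
  ext j
  by_cases hj : j = i
  · subst hj; simp
  · simp [hj, hzero j hj]

theorem intParallel_neg {r : ℕ} {u v : Fin r → ℤ} (h : ∀ i, u i = -v i) : IntParallel u v := by
  intro hli
  have h1 := LinearIndependent.pair_iff.1 hli 1 1 (by ext i; simp [h])
  exact one_ne_zero h1.1

theorem pairMultiset_swap {m : ℕ} (u v : Fin m → ℤ) :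
    pairMultiset v u = (pairMultiset u v).map Prod.swap := by
  simp [pairMultiset, Multiset.map_map, and_comm]

theorem sum_pairMultiset {m : ℕ} (u v : Fin m → ℤ) :
    (pairMultiset u v).sum = (∑ i, u i, ∑ i, v i) := by
  change ∑ i with ¬(u i = 0 ∧ v i = 0), (u i, v i) = _
  rw [Finset.sum_filter_of_ne fun i _ h => by simpa using h]
  exact Prod.ext (by simp [Prod.fst_sum]) (by simp [Prod.snd_sum])

theorem pairMultiset_le {m : ℕ} (u v : Fin m → ℤ) :
    pairMultiset u v ≤ Finset.univ.val.map fun i => (u i, v i) :=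
  Multiset.map_le_map (Finset.val_le_iff.2 (Finset.filter_subset _ _))

theorem zero_notMem_pairMultiset {m : ℕ} (u v : Fin m → ℤ) : (0, 0) ∉ pairMultiset u v := by
  simp [pairMultiset]

theorem map_univ_val_castSucc {α : Type*} {n : ℕ} (f : Fin (n + 1) → α) :
    Finset.univ.val.map f =
      f (Fin.last n) ::ₘ (Finset.univ : Finset (Fin n)).val.map fun i => f i.castSucc := by
  rw [Fin.univ_castSuccEmb, Finset.cons_val, Multiset.map_cons, Finset.map_val, Multiset.map_map]
  rfl

/-- Configurations with small subsum pairs satisfying the side conditions are exceptional. -/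
theorem exists_mem_exceptionalLists {m : ℕ} {a b : Fin m → ℤ} (hab : a ≠ b)
    (hsuma : ∑ i, a i = -1) (hsumb : ∑ i, b i = -1) (ha : ∀ i, a ≠ Pi.single i (-1))
    (hb : ∀ i, b ≠ Pi.single i (-1))
    (hsmall : ∀ p, IsSubsumPair (pairMultiset a b + {(1, 0), (0, 1)}) p → smallPair p = true) :
    ∃ l ∈ exceptionalLists, (l : Multiset (ℤ × ℤ)) = pairMultiset a b := by
  obtain ⟨l, hl, hl'⟩ := exists_admissible (zero_notMem_pairMultiset a b) hsmall
  simp only [admissible, Bool.or_eq_true, decide_eq_true_eq, beq_iff_eq] at hl'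
  rcases hl' with (((hs | hc) | hc) | heq) | hmem
  · refine absurd ?_ hs
    rw [← Multiset.sum_coe, hl, sum_pairMultiset, hsuma, hsumb]
  · obtain ⟨i, hi⟩ := exists_eq_single_of_countP (u := a) (v := b) (g := Prod.fst) (a := a)
      (fun _ => rfl) (fun _ h => h.1) (by rw [← hl, ← hc]; simp)
    exact absurd (hsuma ▸ hi) (ha i)
  · obtain ⟨i, hi⟩ := exists_eq_single_of_countP (u := a) (v := b) (g := Prod.snd) (a := b)
      (fun _ => rfl) (fun _ h => h.2) (by rw [← hl, ← hc]; simp)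
    exact absurd (hsumb ▸ hi) (hb i)
  · refine absurd (funext fun i => ?_) hab
    by_contra hne
    have hmem : (a i, b i) ∈ pairMultiset a b :=
      Multiset.mem_map.2 ⟨i, Finset.mem_filter.2 ⟨Finset.mem_univ i, fun h =>
        hne (h.1.trans h.2.symm)⟩, rfl⟩
    rw [← hl] at hmem
    exact hne (by simpa using List.all_eq_true.1 heq _ hmem)
  · exact ⟨l, hmem, hl⟩

theorem two_element_independent_flats (r : ℕ) (hr : 3 ≤ r)
    (a b : Fin (r - 1) → ℤ) (hab : a ≠ b)
    (hsuma : ∑ i, a i = -1) (hsumb : ∑ i, b i = -1)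
    (A : Matrix (Fin (r + 1)) (PairIdx (r + 1) ⊕ Bool) ℤ)
    (hA : A = Matrix.of fun i =>
      Sum.elim (fun p => Dmat (r + 1) i p)
        (fun t =>
          if t then
            (if h : i.val < r - 1 then b ⟨i.val, h⟩ else if i.val = r - 1 then 0 else 1)
          else
            (if h : i.val < r - 1 then a ⟨i.val, h⟩ else if i.val = r - 1 then 1 else 0)))
    (hnonpar : ∀ j j', j ≠ j' → ¬ IntParallel (fun i => A i j) (fun i => A i j'))
    (hmod : ∀ (g : Fin r → Fin (r + 1)) (f : Fin r → PairIdx (r + 1) ⊕ Bool),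
      Function.Injective g → Function.Injective f →
      |(A.submatrix g f).det| ≤ 3) :
    pairMultiset a b ∈
      ({ ({(-3, -2), (2, 1)} : Multiset (ℤ × ℤ)),
         ({(-2, 1), (1, -2)} : Multiset (ℤ × ℤ)),
         ({(-2, 1), (1, -1), (0, -1)} : Multiset (ℤ × ℤ)),
         ({(-2, -1), (1, 1), (0, -1)} : Multiset (ℤ × ℤ)),
         ({(-2, -1), (2, 1), (-1, -1)} : Multiset (ℤ × ℤ)),
         ({(-1, -1), (-1, 1), (1, -1)} : Multiset (ℤ × ℤ)),
         ({(-1, -1), (1, 1), (-1, 0), (0, -1)} : Multiset (ℤ × ℤ)),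
         ({(-1, 1), (1, -1), (-1, 0), (0, -1)} : Multiset (ℤ × ℤ)) } :
        Set (Multiset (ℤ × ℤ))) ∨
    pairMultiset b a ∈
      ({ ({(-3, -2), (2, 1)} : Multiset (ℤ × ℤ)),
         ({(-2, 1), (1, -2)} : Multiset (ℤ × ℤ)),
         ({(-2, 1), (1, -1), (0, -1)} : Multiset (ℤ × ℤ)),
         ({(-2, -1), (1, 1), (0, -1)} : Multiset (ℤ × ℤ)),
         ({(-2, -1), (2, 1), (-1, -1)} : Multiset (ℤ × ℤ)),
         ({(-1, -1), (-1, 1), (1, -1)} : Multiset (ℤ × ℤ)),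
         ({(-1, -1), (1, 1), (-1, 0), (0, -1)} : Multiset (ℤ × ℤ)),
         ({(-1, 1), (1, -1), (-1, 0), (0, -1)} : Multiset (ℤ × ℤ)) } :
        Set (Multiset (ℤ × ℤ))) := by
  obtain ⟨m, rfl⟩ : ∃ m, r = m + 1 := ⟨r - 1, by omega⟩
  change Fin m → ℤ at a b
  change ∑ i, a i = -1 at hsuma
  change ∑ i, b i = -1 at hsumb
  have hD : ∀ i p, A i (Sum.inl p) = Dmat (m + 1 + 1) i p := fun i p => by rw [hA]; rfl
  obtain ⟨u, hu⟩ : ∃ u : Fin (m + 2) → ℤ, ∀ i, A i (Sum.inr false) = u i := ⟨_, fun _ => rfl⟩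
  obtain ⟨v, hv⟩ : ∃ v : Fin (m + 2) → ℤ, ∀ i, A i (Sum.inr true) = v i := ⟨_, fun _ => rfl⟩
  have hua : ∀ i : Fin m, u i.castSucc.castSucc = a i := fun i => by simp [← hu, hA]
  have hu1 : u (Fin.last m).castSucc = 1 := by simp [← hu, hA]
  have hu0 : u (Fin.last (m + 1)) = 0 := by simp [← hu, hA]
  have hvb : ∀ i : Fin m, v i.castSucc.castSucc = b i := fun i => by simp [← hv, hA]
  have hv0 : v (Fin.last m).castSucc = 0 := by simp [← hv, hA]
  have hv1 : v (Fin.last (m + 1)) = 1 := by simp [← hv, hA]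
  have hsumu : ∑ i, u i = 0 := by simp [Fin.sum_univ_castSucc, hua, hu1, hu0, hsuma]
  have hsumv : ∑ i, v i = 0 := by simp [Fin.sum_univ_castSucc, hvb, hv1, hv0, hsumb]
  have hle : pairMultiset a b + {(1, 0), (0, 1)} ≤ Finset.univ.val.map fun i => (u i, v i) := by
    simp only [map_univ_val_castSucc, hua, hu1, hu0, hvb, hv1, hv0]
    rw [Multiset.insert_eq_cons, Multiset.add_cons, Multiset.add_comm, Multiset.singleton_add,
      Multiset.cons_swap]
    exact Multiset.cons_le_cons _ (Multiset.cons_le_cons _ (pairMultiset_le a b))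
  have hsmall : ∀ p, IsSubsumPair (pairMultiset a b + {(1, 0), (0, 1)}) p →
      smallPair p = true := by
    intro p hp
    obtain ⟨X, Y, hXY, hX, hY⟩ := (hp.mono hle).exists_disjoint
    have h := abs_det_sums_le A hD hmod u v hu hv hsumu hsumv X Y hXY
    have hbu := abs_sum_le A hD hmod false (by simpa only [hu] using hsumu)
    have hbv := abs_sum_le A hD hmod true (by simpa only [hv] using hsumv)
    simp only [hu] at hbu
    simp only [hv] at hbv
    have hX1 := hbu X
    have hX2 := hbv X
    have hY1 := hbu Y
    have hY2 := hbv Y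
    simp only [smallPair, Bool.and_eq_true, Nat.ble_eq, ← hX, ← hY, Prod.fst_sum, Prod.snd_sum]
    rw [Int.abs_eq_natAbs] at h hX1 hX2 hY1 hY2
    exact ⟨⟨⟨⟨by exact_mod_cast hX1, by exact_mod_cast hX2⟩, by exact_mod_cast hY1⟩,
      by exact_mod_cast hY2⟩, by exact_mod_cast h⟩
  have hlt : ∀ i : Fin m, i.castSucc.castSucc < (Fin.last m).castSucc := fun i => i.2
  have hlt' : ∀ i : Fin m, i.castSucc.castSucc < Fin.last (m + 1) := fun i =>
    Fin.castSucc_lt_last _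
  have ha : ∀ i, a ≠ Pi.single i (-1) := by
    rintro i rfl
    refine hnonpar (Sum.inr false) (Sum.inl ⟨(i.castSucc.castSucc, (Fin.last m).castSucc),
      hlt i⟩) (by simp) (intParallel_neg fun j => ?_)
    simp only [hu, hD, Dmat, Matrix.of_apply]
    induction j using Fin.lastCases with
    | last => simp [hu0, (hlt' i).ne', (Fin.castSucc_lt_last (Fin.last m)).ne']
    | cast j =>
      induction j using Fin.lastCases with
      | last => simp [hu1, (hlt i).ne']
      | cast j => by_cases h : j = i <;> simp [hua, h, (hlt j).ne]
  have hb : ∀ i, b ≠ Pi.single i (-1) := by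
    rintro i rfl
    refine hnonpar (Sum.inr true) (Sum.inl ⟨(i.castSucc.castSucc, Fin.last (m + 1)),
      hlt' i⟩) (by simp) (intParallel_neg fun j => ?_)
    simp only [hv, hD, Dmat, Matrix.of_apply]
    induction j using Fin.lastCases with
    | last => simp [hv1, (hlt' i).ne']
    | cast j =>
      induction j using Fin.lastCases with
      | last => simp [hv0, (hlt i).ne']
      | cast j => by_cases h : j = i <;> simp [hvb, h, (hlt' j).ne]
  obtain ⟨l, hmem, hl⟩ := exists_mem_exceptionalLists hab hsuma hsumb ha hb hsmall
  rw [pairMultiset_swap a b, ← hl]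
  simp only [exceptionalLists, List.mem_cons, List.not_mem_nil, or_false] at hmem
  simp only [Set.mem_insert_iff, Set.mem_singleton_iff]
  rcases hmem with rfl | rfl | rfl | rfl | rfl | rfl | rfl | rfl | rfl | rfl | rfl | rfl <;>
    decide
end

section
/- Let r ≥ 3 be an integer and let a, b, c ∈ ℤ^{r−2} be pairwise distinct vectors with Σ a_i = Σ b_i = Σ c_i = −1. Let A be the (r+1) × (binom(r+1,2)+3) integer matrix whose columns are the columns of D_{r+1} together with the three columns (a, 1, 0, 0)ᵀ, (b, 0, 1, 0)ᵀ, (c, 0, 0, 1)ᵀ (so the rows of A sum to the zero vector). If the columns of A are pairwise non-parallel, then A is not 3-modular: some r×r submatrix of A has determinant of absolute value at least 4. -/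
/-- The sum of the entries of `v` over the block of `φ` labelled `k`. -/
def blockSum {ι κ : Type*} [Fintype ι] [DecidableEq κ] (φ : ι → κ) (v : ι → ℤ) (k : κ) : ℤ :=
  ∑ i, if φ i = k then v i else 0

/-- The block sum of the vector `v` extended by one further entry `1` lying in block `x`. -/
def extBlockSum {ι κ : Type*} [Fintype ι] [DecidableEq κ] (φ : ι → κ) (x : κ) (v : ι → ℤ)
    (k : κ) : ℤ :=
  blockSum φ v k + if x = k then 1 else 0

/-- The determinant of the block sums of two extended vectors. -/
def pairDet {ι : Type*} [Fintype ι] (a b : ι → ℤ) (φ : ι → Fin 3) (x y : Fin 3) : ℤ :=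
  extBlockSum φ x a 0 * extBlockSum φ y b 1 - extBlockSum φ y b 0 * extBlockSum φ x a 1

/-- The determinant of the block sums of three extended vectors. -/
def tripleDet {ι : Type*} [Fintype ι] (a b c : ι → ℤ) (φ : ι → Fin 4) (x y z : Fin 4) : ℤ :=
  extBlockSum φ x a 0 *
      (extBlockSum φ y b 1 * extBlockSum φ z c 2 - extBlockSum φ z c 1 * extBlockSum φ y b 2) -
    extBlockSum φ y b 0 *
      (extBlockSum φ x a 1 * extBlockSum φ z c 2 - extBlockSum φ z c 1 * extBlockSum φ x a 2) +
    extBlockSum φ z c 0 *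
      (extBlockSum φ x a 1 * extBlockSum φ y b 2 - extBlockSum φ y b 1 * extBlockSum φ x a 2)

/-- All block sums of one extended vector have absolute value at most `3`. -/
def SingleBound {ι : Type*} [Fintype ι] (a : ι → ℤ) : Prop :=
  ∀ (φ : ι → Fin 2) (x : Fin 2), |extBlockSum φ x a 0| ≤ 3

/-- All block determinants of two extended vectors have absolute value at most `3`. -/
def PairBound {ι : Type*} [Fintype ι] (a b : ι → ℤ) : Prop :=
  ∀ (φ : ι → Fin 3) (x y : Fin 3), |pairDet a b φ x y| ≤ 3

/-- All block determinants of three extended vectors have absolute value at most `3`. -/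
def TripleBound {ι : Type*} [Fintype ι] (a b c : ι → ℤ) : Prop :=
  ∀ (φ : ι → Fin 4) (x y z : Fin 4), |tripleDet a b c φ x y z| ≤ 3

section BlockSum

variable {ι κ μ : Type*} [Fintype ι] [DecidableEq κ]

theorem blockSum_blockSum [Fintype κ] [DecidableEq μ] (ψ : ι → κ) (φ : κ → μ) (v : ι → ℤ) :
    blockSum φ (blockSum ψ v) = blockSum (φ ∘ ψ) v := by
  funext k
  simp only [blockSum, ← Finset.sum_filter, Function.comp]
  rw [Finset.sum_comm' (t' := Finset.univ.filter fun i => φ (ψ i) = k)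
    (s' := fun i => {ψ i})]
  · simp
  · intro x y
    simp only [Finset.mem_filter, Finset.mem_univ, true_and, Finset.mem_singleton]
    constructor
    · rintro ⟨h, rfl⟩
      exact ⟨rfl, h⟩
    · rintro ⟨rfl, h⟩
      exact ⟨h, rfl⟩

theorem extBlockSum_blockSum [Fintype κ] [DecidableEq μ] (ψ : ι → κ) (φ : κ → μ) (x : μ)
    (v : ι → ℤ) : extBlockSum φ x (blockSum ψ v) = extBlockSum (φ ∘ ψ) x v := by
  funext k
  simp only [extBlockSum, blockSum_blockSum]

theorem sum_blockSum [Fintype κ] (ψ : ι → κ) (v : ι → ℤ) :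
    ∑ k, blockSum ψ v k = ∑ i, v i := by
  simp only [blockSum]
  rw [Finset.sum_comm]
  simp

theorem blockSum_eq_of_isolated (ψ : ι → κ) (v : ι → ℤ) (x : ι)
    (h : ∀ y, ψ y = ψ x ↔ y = x) : blockSum ψ v (ψ x) = v x := by
  classical
  simp [blockSum, h]

theorem blockSum_nonpos (ψ : ι → κ) (v : ι → ℤ) (k : κ) (h : ∀ i, ψ i = k → v i ≤ 0) :
    blockSum ψ v k ≤ 0 := by
  refine Finset.sum_nonpos fun i _ => ?_
  split_ifs with hi
  · exact h i hi
  · exact le_rfl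

theorem SingleBound.merge [Fintype κ] {a : ι → ℤ} (h : SingleBound a) (ψ : ι → κ) :
    SingleBound (blockSum ψ a) := by
  intro φ x
  rw [extBlockSum_blockSum]
  exact h _ _

theorem PairBound.merge [Fintype κ] {a b : ι → ℤ} (h : PairBound a b) (ψ : ι → κ) :
    PairBound (blockSum ψ a) (blockSum ψ b) := by
  intro φ x y
  simp only [pairDet, extBlockSum_blockSum]
  exact h _ _ _

theorem TripleBound.merge [Fintype κ] {a b c : ι → ℤ} (h : TripleBound a b c) (ψ : ι → κ) :
    TripleBound (blockSum ψ a) (blockSum ψ b) (blockSum ψ c) := by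
  intro φ x y z
  simp only [tripleDet, extBlockSum_blockSum]
  exact h _ _ _ _

theorem SingleBound.sum_mem_Icc {a : ι → ℤ} (h : SingleBound a) (S : Finset ι) :
    ∑ i ∈ S, a i ∈ Finset.Icc (-3) 2 := by
  classical
  have key : blockSum (fun i => if i ∈ S then (0 : Fin 2) else 1) a 0 = ∑ i ∈ S, a i := by
    simp only [blockSum, ← Finset.sum_filter]
    congr 1
    ext i
    by_cases hi : i ∈ S <;> simp [hi]
  have h0 := h (fun i => if i ∈ S then (0 : Fin 2) else 1) 0
  have h1 := h (fun i => if i ∈ S then (0 : Fin 2) else 1) 1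
  simp only [extBlockSum, key] at h0 h1
  simp only [if_true, abs_le] at h0 h1
  rw [Finset.mem_Icc]
  simp at h1
  omega

end BlockSum

set_option synthInstance.maxHeartbeats 400000 in
set_option synthInstance.maxSize 100000 in
theorem pair_signs_decide :
    ∀ p ∈ Finset.Icc (1 : ℤ) 2, ∀ q ∈ Finset.Icc (1 : ℤ) 2,
    ∀ s ∈ Finset.Icc (-3 : ℤ) 2, ∀ t ∈ Finset.Icc (-3 : ℤ) 2,
      p + s ≤ 2 → -1 - s ≤ 2 → q + t ≤ 2 → -1 - t ≤ 2 →
      (∀ φ ∈ [![0, 1, 2], ![0, 1, 0], ![0, 1, 1]], ∀ x ∈ [((0 : Fin 3), (1 : Fin 3)), (2, 2)],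
        |pairDet ![p, s, -1 - p - s] ![t, q, -1 - t - q] φ x.1 x.2| ≤ 3) →
      p = 1 ∧ q = 1 ∧ (s < 0 ∧ t < 0 ∨ s = 1 ∧ t = 1) := by
  decide +kernel

theorem pair_common_decide :
    ∀ s ∈ Finset.Icc (-3 : ℤ) 0, ∀ t ∈ Finset.Icc (-3 : ℤ) 0,
      (∀ φ ∈ [![0, 0, 1, 2], ![2, 2, 0, 1], ![0, 1, 2, 0]],
        ∀ x ∈ [((0 : Fin 3), (1 : Fin 3)), (2, 2)],
        |pairDet ![1, 1, s, -3 - s] ![1, 1, t, -3 - t] φ x.1 x.2| ≤ 3) → s = t := by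
  decide +kernel

set_option synthInstance.maxHeartbeats 400000 in
set_option synthInstance.maxSize 100000 in
theorem triple_common_decide :
    ∀ p₁ ∈ Finset.Icc (1 : ℤ) 2, ∀ x₁ ∈ Finset.Icc (-3 : ℤ) 0, ∀ y₁ ∈ Finset.Icc (-3 : ℤ) 0,
      0 ≤ 1 + p₁ + x₁ + y₁ →
    ∀ p₂ ∈ Finset.Icc (1 : ℤ) 2, ∀ x₂ ∈ Finset.Icc (-3 : ℤ) 0, ∀ y₂ ∈ Finset.Icc (-3 : ℤ) 0,
      0 ≤ 1 + p₂ + x₂ + y₂ →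
      ¬ (p₁ = p₂ ∧ x₁ = x₂ ∧ y₁ = y₂) →
      (∀ φ ∈ [(![0, 1, 1, 2], (0 : Fin 3), (2 : Fin 3)), (![0, 1, 1, 2], 2, 0),
          (![0, 1, 2, 1], 0, 2), (![0, 1, 2, 1], 2, 0), (![0, 1, 2, 2], 0, 1),
          (![0, 1, 2, 2], 1, 0)],
        |pairDet ![p₁, x₁, y₁, -1 - p₁ - x₁ - y₁] ![p₂, x₂, y₂, -1 - p₂ - x₂ - y₂]
          φ.1 φ.2.1 φ.2.2| ≤ 3) →
    ∀ p₃ ∈ Finset.Icc (1 : ℤ) 2, ∀ x₃ ∈ Finset.Icc (-3 : ℤ) 0, ∀ y₃ ∈ Finset.Icc (-3 : ℤ) 0,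
      0 ≤ 1 + p₃ + x₃ + y₃ →
      ¬ (p₁ = p₃ ∧ x₁ = x₃ ∧ y₁ = y₃) → ¬ (p₂ = p₃ ∧ x₂ = x₃ ∧ y₂ = y₃) →
      (∀ φ ∈ [(![0, 1, 1, 2], (0 : Fin 3), (2 : Fin 3)), (![0, 1, 1, 2], 2, 0),
          (![0, 1, 2, 1], 0, 2), (![0, 1, 2, 1], 2, 0), (![0, 1, 2, 2], 0, 1),
          (![0, 1, 2, 2], 1, 0)],
        |pairDet ![p₁, x₁, y₁, -1 - p₁ - x₁ - y₁] ![p₃, x₃, y₃, -1 - p₃ - x₃ - y₃]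
          φ.1 φ.2.1 φ.2.2| ≤ 3) →
      (∀ φ ∈ [(![0, 1, 1, 2], (0 : Fin 3), (2 : Fin 3)), (![0, 1, 1, 2], 2, 0),
          (![0, 1, 2, 1], 0, 2), (![0, 1, 2, 1], 2, 0), (![0, 1, 2, 2], 0, 1),
          (![0, 1, 2, 2], 1, 0)],
        |pairDet ![p₂, x₂, y₂, -1 - p₂ - x₂ - y₂] ![p₃, x₃, y₃, -1 - p₃ - x₃ - y₃]
          φ.1 φ.2.1 φ.2.2| ≤ 3) →
      ¬ ∀ χ ∈ [((0 : Fin 4), (1 : Fin 4), (2 : Fin 4)), (0, 1, 3), (0, 2, 1), (0, 2, 3),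
          (0, 3, 1), (0, 3, 2), (1, 0, 2), (1, 0, 3), (1, 2, 0), (1, 3, 0), (2, 0, 3),
          (2, 3, 0)],
        |tripleDet ![p₁, x₁, y₁, -1 - p₁ - x₁ - y₁] ![p₂, x₂, y₂, -1 - p₂ - x₂ - y₂]
          ![p₃, x₃, y₃, -1 - p₃ - x₃ - y₃] ![0, 1, 2, 3] χ.1 χ.2.1 χ.2.2| ≤ 3 := by
  decide +kernel

theorem triple_two_common_decide :
    ∀ x₁ ∈ Finset.Icc (-2 : ℤ) (-1), ∀ y₁ ∈ Finset.Icc (-1 : ℤ) 0, 0 ≤ 2 + x₁ + y₁ →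
    ∀ x₂ ∈ Finset.Icc (-2 : ℤ) (-1), ∀ y₂ ∈ Finset.Icc (-1 : ℤ) 0, 0 ≤ 2 + x₂ + y₂ →
    ∀ x₃ ∈ Finset.Icc (-2 : ℤ) (-1), ∀ y₃ ∈ Finset.Icc (-1 : ℤ) 0, 0 ≤ 2 + x₃ + y₃ →
      ¬ (x₁ = x₂ ∧ y₁ = y₂) →
      ¬ ∀ φ ∈ [(![0, 1, 2, 2], (0 : Fin 4), (3 : Fin 4), (3 : Fin 4)), (![0, 1, 2, 2], 3, 0, 3),
          (![0, 1, 1, 2], 2, 3, 3), (![0, 1, 1, 2], 3, 2, 3), (![0, 1, 1, 2], 0, 3, 3),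
          (![0, 1, 1, 2], 3, 0, 3), (![0, 1, 2, 0], 2, 3, 3), (![0, 1, 2, 0], 3, 2, 3),
          (![0, 1, 2, 1], 0, 3, 3), (![0, 1, 2, 1], 3, 0, 3)],
        |tripleDet ![1, x₁, y₁, -2 - x₁ - y₁] ![1, x₂, y₂, -2 - x₂ - y₂]
          ![x₃, 1, y₃, -2 - x₃ - y₃] φ.1 φ.2.1 φ.2.2.1 φ.2.2.2| ≤ 3 := by
  decide +kernel

/-- The partition isolating `i`, `j` and `k` from each other and from everything else. -/
def isolate {ι : Type*} [DecidableEq ι] (i j k : ι) (x : ι) : Fin 4 :=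
  if x = i then 0 else if x = j then 1 else if x = k then 2 else 3

section Isolate

variable {ι : Type*} [DecidableEq ι]

theorem isolate_isolated {i j k x : ι} (hx : x = i ∨ x = j ∨ x = k) (y : ι) :
    isolate i j k y = isolate i j k x ↔ y = x := by
  unfold isolate
  grind

variable [Fintype ι]

theorem blockSum_isolate {i j k x : ι} (hx : x = i ∨ x = j ∨ x = k) (v : ι → ℤ) :
    blockSum (isolate i j k) v (isolate i j k x) = v x :=
  blockSum_eq_of_isolated _ _ _ (isolate_isolated hx)

theorem blockSum_isolate_zero (i j k : ι) (v : ι → ℤ) :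
    blockSum (isolate i j k) v 0 = v i := by
  have h := blockSum_isolate (i := i) (j := j) (k := k) (x := i) (by simp) v
  simpa [isolate] using h

theorem blockSum_isolate_one {i j : ι} (k : ι) (hij : i ≠ j) (v : ι → ℤ) :
    blockSum (isolate i j k) v 1 = v j := by
  have h := blockSum_isolate (i := i) (j := j) (k := k) (x := j) (by simp) v
  simpa [isolate, hij.symm] using h

theorem blockSum_isolate_two {i j k : ι} (hik : i ≠ k) (hjk : j ≠ k) (v : ι → ℤ) :
    blockSum (isolate i j k) v 2 = v k := by
  have h := blockSum_isolate (i := i) (j := j) (k := k) (x := k) (by simp) v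
  simpa [isolate, hik.symm, hjk.symm] using h

theorem sum_blockSum_isolate (i j k : ι) (v : ι → ℤ) :
    blockSum (isolate i j k) v 0 + blockSum (isolate i j k) v 1 +
      blockSum (isolate i j k) v 2 + blockSum (isolate i j k) v 3 = ∑ x, v x := by
  rw [← sum_blockSum (isolate i j k) v, Fin.sum_univ_four]

theorem blockSum_isolate_nonpos {i : ι} (j k : ι) {v : ι → ℤ} (h : ∀ x, x ≠ i → v x ≤ 0)
    {g : Fin 4} (hg : g ≠ 0) : blockSum (isolate i j k) v g ≤ 0 := by
  refine blockSum_nonpos _ _ _ fun x hx => h x ?_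
  rintro rfl
  exact hg (by simpa [isolate] using hx.symm)

theorem blockSum_isolate_nonpos_of_ne_one {i j : ι} (k : ι) (hij : i ≠ j) {v : ι → ℤ}
    (h : ∀ x, x ≠ j → v x ≤ 0) {g : Fin 4} (hg : g ≠ 1) :
    blockSum (isolate i j k) v g ≤ 0 := by
  refine blockSum_nonpos _ _ _ fun x hx => h x ?_
  rintro rfl
  exact hg (by simpa [isolate, hij.symm] using hx.symm)

end Isolate

theorem eq_vec_four (v : Fin 4 → ℤ) : v = ![v 0, v 1, v 2, v 3] := by
  funext i
  fin_cases i <;> rfl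

theorem eq_vec_three (v : Fin 3 → ℤ) : v = ![v 0, v 1, v 2] := by
  funext i
  fin_cases i <;> rfl

/-- Two bounded vectors on three blocks, positive on distinct blocks. -/
theorem PairBound.signs_fin_three {a b : Fin 3 → ℤ} (h : PairBound a b) (ha : SingleBound a)
    (hb : SingleBound b) (hsa : ∑ i, a i = -1) (hsb : ∑ i, b i = -1) (ha0 : 0 < a 0)
    (hb1 : 0 < b 1) :
    a 0 = 1 ∧ b 1 = 1 ∧ (a 1 < 0 ∧ b 0 < 0 ∨ a 1 = 1 ∧ b 0 = 1) := by
  rw [Fin.sum_univ_three] at hsa hsb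
  have a0 := ha.sum_mem_Icc {0}
  have a1 := ha.sum_mem_Icc {1}
  have b0 := hb.sum_mem_Icc {0}
  have b1 := hb.sum_mem_Icc {1}
  have a01 := ha.sum_mem_Icc {0, 1}
  have a02 := ha.sum_mem_Icc {0, 2}
  have b01 := hb.sum_mem_Icc {0, 1}
  have b12 := hb.sum_mem_Icc {1, 2}
  simp only [Finset.sum_singleton] at a0 a1 b0 b1
  rw [Finset.sum_pair (by decide)] at a01 a02 b01 b12
  rw [Finset.mem_Icc] at a01 a02 b01 b12 a0 b1
  refine pair_signs_decide (a 0) (by simp; omega) (b 1) (by simp; omega) (a 1) a1 (b 0) b0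
    (by omega) (by omega) (by omega) (by omega) fun φ _ x _ => ?_
  have e₁ : ![a 0, a 1, -1 - a 0 - a 1] = a := by
    conv_rhs => rw [eq_vec_three a]
    congr 3
    omega
  have e₂ : ![b 0, b 1, -1 - b 0 - b 1] = b := by
    conv_rhs => rw [eq_vec_three b]
    congr 3
    omega
  rw [e₁, e₂]
  exact h _ _ _

/-- Two bounded vectors on three blocks, merged from four, positive on distinct blocks. -/
theorem PairBound.signs_fin_four {a b : Fin 4 → ℤ} (h : PairBound a b) (ha : SingleBound a)
    (hb : SingleBound b) (hsa : ∑ i, a i = -1) (hsb : ∑ i, b i = -1) (ha0 : 0 < a 0)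
    (hb1 : 0 < b 1) :
    a 0 = 1 ∧ b 1 = 1 ∧ (a 1 < 0 ∧ b 0 < 0 ∨ a 1 = 1 ∧ b 0 = 1 ∧ a 2 = b 2) ∧
      a 2 ≤ 0 ∧ b 2 ≤ 0 := by
  have key : ∀ ψ : Fin 4 → Fin 3, 0 < blockSum ψ a 0 → 0 < blockSum ψ b 1 →
      blockSum ψ a 0 = 1 ∧ blockSum ψ b 1 = 1 ∧
        (blockSum ψ a 1 < 0 ∧ blockSum ψ b 0 < 0 ∨ blockSum ψ a 1 = 1 ∧ blockSum ψ b 0 = 1) :=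
    fun ψ h0 h1 => (h.merge ψ).signs_fin_three (ha.merge ψ) (hb.merge ψ)
      (by rw [sum_blockSum, hsa]) (by rw [sum_blockSum, hsb]) h0 h1
  have k₁ := key ![0, 1, 2, 2]
  have k₂ := key ![0, 1, 0, 2]
  have k₃ := key ![0, 1, 1, 2]
  have k₄ := key ![0, 1, 2, 0]
  have k₅ := key ![0, 1, 2, 1]
  simp [blockSum, Fin.sum_univ_four] at k₁ k₂ k₃ k₄ k₅
  have k := k₁ ha0 hb1
  have ha2 : a 2 ≤ 0 := by
    by_contra hc
    have := k₂ (by omega) hb1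
    omega
  have hb2 : b 2 ≤ 0 := by
    by_contra hc
    have := k₃ ha0 (by omega)
    omega
  refine ⟨k.1, k.2.1, ?_, ha2, hb2⟩
  rcases k.2.2 with hk | hk
  · exact Or.inl hk
  · refine Or.inr ⟨hk.1, hk.2, ?_⟩
    have a2 := ha.sum_mem_Icc {2}
    have b2 := hb.sum_mem_Icc {2}
    simp only [Finset.sum_singleton, Finset.mem_Icc] at a2 b2
    rw [Fin.sum_univ_four] at hsa hsb
    refine pair_common_decide (a 2) (by simp; omega) (b 2) (by simp; omega) fun φ _ x _ => ?_
    have e₁ : ![1, 1, a 2, -3 - a 2] = a := by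
      conv_rhs => rw [eq_vec_four a, k.1, hk.1]
      congr 4
      omega
    have e₂ : ![1, 1, b 2, -3 - b 2] = b := by
      conv_rhs => rw [eq_vec_four b, hk.2, k.2.1]
      congr 4
      omega
    rw [e₁, e₂]
    exact h _ _ _

/-- Two distinct bounded vectors that are positive at distinct places. -/
theorem PairBound.signs {ι : Type*} [Fintype ι] [DecidableEq ι] {a b : ι → ℤ}
    (h : PairBound a b) (ha : SingleBound a)
    (hb : SingleBound b) (hsa : ∑ i, a i = -1) (hsb : ∑ i, b i = -1) (hab : a ≠ b)
    {i j : ι} (hij : i ≠ j) (hai : 0 < a i) (hbj : 0 < b j) :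
    a i = 1 ∧ b j = 1 ∧ a j < 0 ∧ b i < 0 ∧ (∀ x, x ≠ i → a x ≤ 0) ∧
      ∀ x, x ≠ j → b x ≤ 0 := by
  have key : ∀ l, i ≠ l → j ≠ l →
      a i = 1 ∧ b j = 1 ∧ (a j < 0 ∧ b i < 0 ∨ a j = 1 ∧ b i = 1 ∧ a l = b l) ∧
        a l ≤ 0 ∧ b l ≤ 0 := by
    intro l hil hjl
    have k := (h.merge (isolate i j l)).signs_fin_four (ha.merge _) (hb.merge _)
      (by rw [sum_blockSum, hsa]) (by rw [sum_blockSum, hsb])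
      (by rwa [blockSum_isolate_zero]) (by rwa [blockSum_isolate_one l hij])
    simpa only [blockSum_isolate_zero, blockSum_isolate_one l hij,
      blockSum_isolate_two hil hjl] using k
  have key' : a i = 1 ∧ b j = 1 ∧ (a j < 0 ∧ b i < 0 ∨ a j = 1 ∧ b i = 1) := by
    have k := (h.merge (isolate i j j)).signs_fin_four (ha.merge _) (hb.merge _)
      (by rw [sum_blockSum, hsa]) (by rw [sum_blockSum, hsb])
      (by rwa [blockSum_isolate_zero]) (by rwa [blockSum_isolate_one j hij])
    simp only [blockSum_isolate_zero, blockSum_isolate_one j hij] at k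
    omega
  have hneg : a j < 0 ∧ b i < 0 := by
    obtain ⟨l, hl⟩ := Function.ne_iff.1 hab
    rcases key'.2.2 with hk | hk
    · exact hk
    · have hil : i ≠ l := by
        rintro rfl
        exact hl (by omega)
      have hjl : j ≠ l := by
        rintro rfl
        exact hl (by omega)
      have := key l hil hjl
      omega
  refine ⟨key'.1, key'.2.1, hneg.1, hneg.2, fun x hx => ?_, fun x hx => ?_⟩
  · by_cases hxj : j = x
    · subst hxj
      exact hneg.1.le
    · exact (key x hx.symm hxj).2.2.2.1
  · by_cases hxi : i = x
    · subst hxi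
      exact hneg.2.le
    · exact (key x hxi hx.symm).2.2.2.2

section Triple

variable {ι : Type*} [Fintype ι] [DecidableEq ι] {a b c : ι → ℤ}

/-- No three bounded vectors are positive at three distinct places with all the signs forced. -/
theorem TripleBound.not_distinct_positive (h : TripleBound a b c)
    (hsa : ∑ i, a i = -1) (hsb : ∑ i, b i = -1) (hsc : ∑ i, c i = -1)
    {i j k : ι} (hij : i ≠ j) (hik : i ≠ k) (hjk : j ≠ k)
    (hai : a i = 1) (hbj : b j = 1) (hck : c k = 1)
    (haj : a j < 0) (hak : a k < 0) (hbi : b i < 0) (hbk : b k < 0) (hci : c i < 0)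
    (hcj : c j < 0) (ha : ∀ x, x ≠ i → a x ≤ 0) (hb : ∀ x, x ≠ j → b x ≤ 0)
    (hc : ∀ x, x ≠ k → c x ≤ 0) : False := by
  have h3 : ∀ x, isolate i j k x = 3 → x ≠ i ∧ x ≠ j ∧ x ≠ k := by
    intro x
    unfold isolate
    grind
  have a3 := blockSum_nonpos (isolate i j k) a 3 fun x hx => ha x (h3 x hx).1
  have b3 := blockSum_nonpos (isolate i j k) b 3 fun x hx => hb x (h3 x hx).2.1
  have c3 := blockSum_nonpos (isolate i j k) c 3 fun x hx => hc x (h3 x hx).2.2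
  have sa := sum_blockSum_isolate i j k a
  have sb := sum_blockSum_isolate i j k b
  have sc := sum_blockSum_isolate i j k c
  simp only [blockSum_isolate_zero, blockSum_isolate_one k hij,
    blockSum_isolate_two hik hjk] at sa sb sc
  have key := h.merge (isolate i j k) ![0, 1, 2, 3] 3 3 3
  rw [eq_vec_four (blockSum _ a), eq_vec_four (blockSum _ b), eq_vec_four (blockSum _ c)] at key
  simp only [blockSum_isolate_zero, blockSum_isolate_one k hij,
    blockSum_isolate_two hik hjk] at key
  rw [hai, hbj, hck, show a j = -1 by omega, show a k = -1 by omega, show b i = -1 by omega,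
    show b k = -1 by omega, show c i = -1 by omega, show c j = -1 by omega,
    show blockSum (isolate i j k) a 3 = 0 by omega,
    show blockSum (isolate i j k) b 3 = 0 by omega,
    show blockSum (isolate i j k) c 3 = 0 by omega] at key
  revert key
  decide +kernel

/-- No three bounded vectors have two distinct ones positive only at `i` and one positive only
at `k ≠ i`. -/
theorem TripleBound.not_two_common_positive (h : TripleBound a b c)
    (hsa : ∑ i, a i = -1) (hsb : ∑ i, b i = -1) (hsc : ∑ i, c i = -1) (hab : a ≠ b)
    {i k : ι} (hik : i ≠ k) (hai : a i = 1) (hbi : b i = 1) (hck : c k = 1)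
    (hak : a k < 0) (hbk : b k < 0) (hci : c i < 0) (ha : ∀ x, x ≠ i → a x ≤ 0)
    (hb : ∀ x, x ≠ i → b x ≤ 0) (hc : ∀ x, x ≠ k → c x ≤ 0) : False := by
  obtain ⟨l, hl⟩ := Function.ne_iff.1 hab
  have hil : i ≠ l := by
    rintro rfl
    exact hl (by omega)
  have a2 := blockSum_isolate_nonpos k l ha (g := 2) (by decide)
  have b2 := blockSum_isolate_nonpos k l hb (g := 2) (by decide)
  have c2 := blockSum_isolate_nonpos_of_ne_one l hik hc (g := 2) (by decide)
  have a3 := blockSum_isolate_nonpos k l ha (g := 3) (by decide)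
  have b3 := blockSum_isolate_nonpos k l hb (g := 3) (by decide)
  have c3 := blockSum_isolate_nonpos_of_ne_one l hik hc (g := 3) (by decide)
  have sa := sum_blockSum_isolate i k l a
  have sb := sum_blockSum_isolate i k l b
  have sc := sum_blockSum_isolate i k l c
  have hne : ¬ (a k = b k ∧ blockSum (isolate i k l) a 2 = blockSum (isolate i k l) b 2) := by
    rintro ⟨h1, h2⟩
    have hkl : k ≠ l := by
      rintro rfl
      exact hl h1
    rw [blockSum_isolate_two hil hkl, blockSum_isolate_two hil hkl] at h2
    exact hl h2
  have hm := h.merge (isolate i k l)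
  rw [eq_vec_four (blockSum _ a), eq_vec_four (blockSum _ b), eq_vec_four (blockSum _ c)] at hm
  simp only [blockSum_isolate_zero, blockSum_isolate_one l hik, hai, hbi, hck] at hm sa sb sc
  rw [show blockSum (isolate i k l) a 3 = -2 - a k - blockSum (isolate i k l) a 2 by omega,
    show blockSum (isolate i k l) b 3 = -2 - b k - blockSum (isolate i k l) b 2 by omega,
    show blockSum (isolate i k l) c 3 = -2 - c i - blockSum (isolate i k l) c 2 by omega] at hm
  exact triple_two_common_decide (a k) (by simp; omega) _ (by simp; omega) (by omega)
    (b k) (by simp; omega) _ (by simp; omega) (by omega)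
    (c i) (by simp; omega) _ (by simp; omega) (by omega) hne fun φ _ => hm _ _ _ _

/-- Three pairwise distinct functions are pairwise distinguished by two points. -/
theorem exists_two_points_separating {α β : Type*} {f g h : α → β} (hfg : f ≠ g) (hfh : f ≠ h)
    (hgh : g ≠ h) :
    ∃ l m, (f l ≠ g l ∨ f m ≠ g m) ∧ (f l ≠ h l ∨ f m ≠ h m) ∧ (g l ≠ h l ∨ g m ≠ h m) := by
  obtain ⟨x, hx⟩ := Function.ne_iff.1 hfg
  obtain ⟨y, hy⟩ := Function.ne_iff.1 hfh
  obtain ⟨z, hz⟩ := Function.ne_iff.1 hgh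
  by_cases hxh : f x = h x
  · exact ⟨x, y, by grind⟩
  · exact ⟨x, z, by grind⟩

/-- No three pairwise distinct bounded vectors are positive only at a common place. -/
theorem TripleBound.not_common_positive (h : TripleBound a b c) (pab : PairBound a b)
    (pac : PairBound a c) (pbc : PairBound b c) (ba : SingleBound a) (bb : SingleBound b)
    (bc : SingleBound c)
    (hsa : ∑ i, a i = -1) (hsb : ∑ i, b i = -1) (hsc : ∑ i, c i = -1) (hab : a ≠ b)
    (hac : a ≠ c) (hbc : b ≠ c)
    {i : ι} (hai : 0 < a i) (hbi : 0 < b i) (hci : 0 < c i) (ha : ∀ x, x ≠ i → a x ≤ 0)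
    (hb : ∀ x, x ≠ i → b x ≤ 0) (hc : ∀ x, x ≠ i → c x ≤ 0) : False := by
  obtain ⟨l, m, hlm⟩ := exists_two_points_separating hab hac hbc
  have hne : ∀ u v : ι → ℤ, ∑ x, u x = -1 → ∑ x, v x = -1 → (u l ≠ v l ∨ u m ≠ v m) →
      ¬ (blockSum (isolate i l m) u 0 = blockSum (isolate i l m) v 0 ∧
        blockSum (isolate i l m) u 1 = blockSum (isolate i l m) v 1 ∧
        blockSum (isolate i l m) u 2 = blockSum (isolate i l m) v 2) := by
    rintro u v hu hv huv ⟨h0, h1, h2⟩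
    have h3 : blockSum (isolate i l m) u 3 = blockSum (isolate i l m) v 3 := by
      have su := sum_blockSum_isolate i l m u
      have sv := sum_blockSum_isolate i l m v
      omega
    have heq : blockSum (isolate i l m) u = blockSum (isolate i l m) v := by
      funext g
      fin_cases g <;> assumption
    rcases huv with huv | huv
    · apply huv
      rw [← blockSum_isolate (i := i) (j := l) (k := m) (x := l) (by simp) u, heq,
        blockSum_isolate (by simp)]
    · apply huv
      rw [← blockSum_isolate (i := i) (j := l) (k := m) (x := m) (by simp) u, heq,
        blockSum_isolate (by simp)]
  have range : ∀ u : ι → ℤ, SingleBound u → ∑ x, u x = -1 → 0 < u i → (∀ x, x ≠ i → u x ≤ 0) →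
      blockSum (isolate i l m) u 0 ∈ Finset.Icc 1 2 ∧
      blockSum (isolate i l m) u 1 ∈ Finset.Icc (-3) 0 ∧
      blockSum (isolate i l m) u 2 ∈ Finset.Icc (-3) 0 ∧
      0 ≤ 1 + blockSum (isolate i l m) u 0 + blockSum (isolate i l m) u 1 +
        blockSum (isolate i l m) u 2 ∧
      blockSum (isolate i l m) u = ![blockSum (isolate i l m) u 0, blockSum (isolate i l m) u 1,
        blockSum (isolate i l m) u 2, -1 - blockSum (isolate i l m) u 0 -
          blockSum (isolate i l m) u 1 - blockSum (isolate i l m) u 2] := by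
    intro u hu hsu hui hneg
    have u0 := hu.sum_mem_Icc {i}
    have u1 := blockSum_isolate_nonpos l m hneg (g := 1) (by decide)
    have u2 := blockSum_isolate_nonpos l m hneg (g := 2) (by decide)
    have u3 := blockSum_isolate_nonpos l m hneg (g := 3) (by decide)
    have su := sum_blockSum_isolate i l m u
    simp only [Finset.sum_singleton, ← blockSum_isolate_zero i l m] at u0 hui
    simp only [Finset.mem_Icc] at u0 ⊢
    refine ⟨by omega, by omega, by omega, by omega, ?_⟩
    conv_lhs => rw [eq_vec_four (blockSum _ u)]
    congr 4
    omega
  obtain ⟨a0, a1, a2, a3, ea⟩ := range a ba hsa hai ha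
  obtain ⟨b0, b1, b2, b3, eb⟩ := range b bb hsb hbi hb
  obtain ⟨c0, c1, c2, c3, ec⟩ := range c bc hsc hci hc
  refine triple_common_decide _ a0 _ a1 _ a2 a3 _ b0 _ b1 _ b2 b3 (hne a b hsa hsb hlm.1)
    (fun φ _ => ?_) _ c0 _ c1 _ c2 c3 (hne a c hsa hsc hlm.2.1) (hne b c hsb hsc hlm.2.2)
    (fun φ _ => ?_) (fun φ _ => ?_) fun χ _ => ?_
  · rw [← ea, ← eb]
    exact pab.merge _ _ _ _
  · rw [← ea, ← ec]
    exact pac.merge _ _ _ _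
  · rw [← eb, ← ec]
    exact pbc.merge _ _ _ _
  · rw [← ea, ← eb, ← ec]
    exact h.merge _ _ _ _ _

end Triple

/-- Three pairwise distinct integer vectors of sum `-1`, each with a positive entry, violate one
of the block determinant bounds. -/
theorem not_forall_bound {ι : Type*} [Fintype ι] [DecidableEq ι] {v : Fin 3 → ι → ℤ}
    (hinj : Function.Injective v) (hsum : ∀ t, ∑ i, v t i = -1) (hpos : ∀ t, ∃ i, 0 < v t i)
    (h1 : ∀ t, SingleBound (v t)) (h2 : ∀ s t, s ≠ t → PairBound (v s) (v t))
    (h3 : ∀ s t u, s ≠ t → s ≠ u → t ≠ u → TripleBound (v s) (v t) (v u)) : False := by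
  have sg : ∀ {s t}, s ≠ t → ∀ {i j}, i ≠ j → 0 < v s i → 0 < v t j → _ :=
    fun {s t} hst {i j} hij hi hj => (h2 s t hst).signs (h1 s) (h1 t) (hsum s) (hsum t)
      (hinj.ne hst) hij hi hj
  by_cases hdis : ∃ s t i j, s ≠ t ∧ i ≠ j ∧ 0 < v s i ∧ 0 < v t j
  · obtain ⟨s, t, i, j, hst, hij, hi, hj⟩ := hdis
    obtain ⟨u, hsu, htu⟩ : ∃ u : Fin 3, s ≠ u ∧ t ≠ u :=
      (by decide : ∀ s t : Fin 3, ∃ u, s ≠ u ∧ t ≠ u) s t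
    obtain ⟨k, hk⟩ := hpos u
    have pst := sg hst hij hi hj
    by_cases hik : i = k
    · subst hik
      have put := sg htu.symm hij hk hj
      exact (h3 s u t hsu hst htu.symm).not_two_common_positive (hsum _) (hsum _) (hsum _)
        (hinj.ne hsu) hij pst.1 put.1 pst.2.1 pst.2.2.1 put.2.2.1 pst.2.2.2.1 pst.2.2.2.2.1
        put.2.2.2.2.1 pst.2.2.2.2.2
    · have psu := sg hsu hik hi hk
      by_cases hjk : j = k
      · subst hjk
        exact (h3 t u s htu hst.symm hsu.symm).not_two_common_positive (hsum _) (hsum _) (hsum _)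
          (hinj.ne htu) hij.symm pst.2.1 psu.2.1 pst.1 pst.2.2.2.1 psu.2.2.2.1 pst.2.2.1
          pst.2.2.2.2.2 psu.2.2.2.2.2 pst.2.2.2.2.1
      · have ptu := sg htu hjk hj hk
        exact (h3 s t u hst hsu htu).not_distinct_positive (hsum _) (hsum _) (hsum _) hij hik hjk
          pst.1 pst.2.1 psu.2.1 pst.2.2.1 psu.2.2.1 pst.2.2.2.1 ptu.2.2.1 psu.2.2.2.1
          ptu.2.2.2.1 pst.2.2.2.2.1 pst.2.2.2.2.2 psu.2.2.2.2.2
  · push Not at hdis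
    obtain ⟨i, hi⟩ := hpos 0
    have hpos' : ∀ t, 0 < v t i := by
      intro t
      by_cases ht : 0 = t
      · exact ht ▸ hi
      · obtain ⟨j, hj⟩ := hpos t
        by_cases hij : i = j
        · exact hij ▸ hj
        · exact absurd hj (hdis 0 t i j ht hij hi).not_gt
    have hneg : ∀ t x, x ≠ i → v t x ≤ 0 := by
      intro t x hx
      obtain ⟨s, hs⟩ := exists_ne t
      exact hdis s t i x hs hx.symm (hpos' s)
    exact (h3 0 1 2 (by decide) (by decide) (by decide)).not_common_positive
      (h2 _ _ (by decide)) (h2 _ _ (by decide)) (h2 _ _ (by decide)) (h1 _) (h1 _) (h1 _)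
      (hsum _) (hsum _) (hsum _) (hinj.ne (by decide)) (hinj.ne (by decide))
      (hinj.ne (by decide)) (hpos' _) (hpos' _) (hpos' _) (hneg _) (hneg _) (hneg _)

/-- The column index of `D_r` belonging to the unordered pair `{i, j}`. -/
def pairIdx {r : ℕ} (i j : Fin r) (h : i ≠ j) : PairIdx r :=
  if hij : i < j then ⟨(i, j), hij⟩ else ⟨(j, i), lt_of_le_of_ne (not_lt.1 hij) h.symm⟩

theorem Dmat_pairIdx {r : ℕ} (k i j : Fin r) (h : i ≠ j) :
    Dmat r k (pairIdx i j h) =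
      (if i < j then 1 else -1) * ((if k = i then 1 else 0) - if k = j then 1 else 0) := by
  unfold Dmat pairIdx
  split_ifs <;> grind [Matrix.of_apply]

/-- Contracting the columns of `D_{r+1}` inside the blocks of a partition: a determinant formed
by block sums of further columns is, up to sign, the determinant of a square submatrix. -/
theorem exists_submatrix_of_block_det {r m : ℕ} {τ : Type*}
    (A : Matrix (Fin (r + 1)) (PairIdx (r + 1) ⊕ τ) ℤ)
    (hD : ∀ i p, A i (Sum.inl p) = Dmat (r + 1) i p)
    (hsum : ∀ t, ∑ i, A i (Sum.inr t) = 0)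
    (κ : Fin m → τ) (hκ : Function.Injective κ) (φ : Fin (r + 1) → Fin (m + 1))
    (hdet : (Matrix.of fun k t : Fin m =>
      blockSum φ (fun i => A i (Sum.inr (κ t))) k.castSucc).det ≠ 0) :
    ∃ (g : Fin r → Fin (r + 1)) (f : Fin r → PairIdx (r + 1) ⊕ τ),
      Function.Injective g ∧ Function.Injective f ∧
      |(A.submatrix g f).det| = |(Matrix.of fun k t : Fin m =>
        blockSum φ (fun i => A i (Sum.inr (κ t))) k.castSucc).det| := by
  set S := Matrix.of fun k t : Fin m =>
    blockSum φ (fun i => A i (Sum.inr (κ t))) k.castSucc with hS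
  have hsurj : Function.Surjective φ := by
    intro k
    by_contra! hk
    have hzero : ∀ t, blockSum φ (fun i => A i (Sum.inr t)) k = 0 := fun t =>
      Finset.sum_eq_zero fun i _ => if_neg (hk i)
    apply hdet
    induction k using Fin.lastCases with
    | cast k => exact Matrix.det_eq_zero_of_row_eq_zero k fun t => hzero _
    | last =>
      rcases Nat.eq_zero_or_pos m with rfl | hm
      · exact absurd (Fin.eq_zero _) (hk 0)
      · rw [← Matrix.exists_vecMul_eq_zero_iff]
        refine ⟨fun _ => 1, fun h => one_ne_zero (congrFun h ⟨0, hm⟩), ?_⟩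
        funext t
        have h := sum_blockSum φ fun i => A i (Sum.inr (κ t))
        rw [Fin.sum_univ_castSucc, hzero, hsum, add_zero] at h
        simpa [Matrix.vecMul, dotProduct, hS] using h
  obtain ⟨ρ, hρ⟩ := hsurj.hasRightInverse
  let N := {i : Fin (r + 1) // ρ (φ i) ≠ i}
  have hN : ∀ (i : N) k, (i : Fin (r + 1)) ≠ ρ k := fun i k h => i.2 (by rw [h, hρ])
  let e : N ⊕ Fin (m + 1) ≃ Fin (r + 1) := Equiv.ofBijective (Sum.elim Subtype.val ρ) <| by
    constructor
    · exact Subtype.val_injective.sumElim hρ.injective hN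
    · intro i
      by_cases hi : ρ (φ i) = i
      · exact ⟨Sum.inr (φ i), hi⟩
      · exact ⟨Sum.inl ⟨i, hi⟩, rfl⟩
  have hcard : Fintype.card (Fin r) = Fintype.card (N ⊕ Fin m) := by
    have := Fintype.card_congr e
    simp only [Fintype.card_sum, Fintype.card_fin] at this ⊢
    omega
  let ε : Fin r ≃ N ⊕ Fin m := Fintype.equivOfCardEq hcard
  let g : N ⊕ Fin m → Fin (r + 1) := Sum.elim Subtype.val fun k => ρ k.castSucc
  let f : N ⊕ Fin m → PairIdx (r + 1) ⊕ τ :=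
    Sum.map (fun i => pairIdx i (ρ (φ i)) (hN i _)) κ
  have hg : Function.Injective g :=
    Subtype.val_injective.sumElim (hρ.injective.comp (Fin.castSucc_injective m)) fun i k => hN i _
  have hf : Function.Injective f := by
    refine Function.Injective.sumMap (fun i j hij => ?_) hκ
    have h := congrArg (Dmat (r + 1) i) hij
    simp only [Dmat_pairIdx, if_neg (hN i _)] at h
    by_contra hne
    rw [if_neg fun h => hne (Subtype.ext h)] at h
    split_ifs at h <;> simp_all
  refine ⟨g ∘ ε, f ∘ ε, hg.comp ε.injective, hf.comp ε.injective, ?_⟩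
  have hsub : A.submatrix (g ∘ ε) (f ∘ ε) = (A.submatrix g f).submatrix ε ε := rfl
  rw [hsub, Matrix.det_submatrix_equiv_self]
  let s : N → ℤ := fun i => if (i : Fin (r + 1)) < ρ (φ i) then 1 else -1
  let E : Matrix (Fin m) N ℤ := Matrix.of fun k i => if φ i = k.castSucc then 1 else 0
  let B : Matrix N (Fin m) ℤ := Matrix.of fun i t => A i (Sum.inr (κ t))
  have hmul : Matrix.fromBlocks 1 0 E 1 * A.submatrix g f =
      Matrix.fromBlocks (Matrix.diagonal s) B 0 S := by
    have hA : A.submatrix g f = Matrix.fromBlocks (Matrix.diagonal s) B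
        (-(E * Matrix.diagonal s)) (Matrix.of fun k t => A (ρ k.castSucc) (Sum.inr (κ t))) := by
      ext i j
      rcases i with i | k <;> rcases j with j | t
      · simp only [Matrix.submatrix_apply, g, f, Sum.elim_inl, Sum.map_inl, hD, Dmat_pairIdx,
          if_neg (hN i _), Matrix.fromBlocks_apply₁₁, Matrix.diagonal_apply, s]
        by_cases h : i = j
        · subst h
          simp
        · have h' : (i : Fin (r + 1)) ≠ j := fun e => h (Subtype.ext e)
          simp [h, h']
      · rfl
      · simp only [Matrix.submatrix_apply, g, f, Sum.elim_inr, Sum.map_inl, hD, Dmat_pairIdx,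
          if_neg (hN j _).symm, Matrix.fromBlocks_apply₂₁, Matrix.neg_apply,
          Matrix.mul_diagonal, s, E, Matrix.of_apply, hρ.injective.eq_iff,
          eq_comm (a := k.castSucc)]
        ring
      · rfl
    rw [hA, Matrix.fromBlocks_multiply]
    congr 1
    · simp
    · simp
    · simp
    · ext k t
      simp only [hS, blockSum, Matrix.of_apply, Matrix.one_mul, Matrix.add_apply,
        Matrix.mul_apply, E, B]
      rw [← e.sum_comp, Fintype.sum_sum_type]
      have he₁ : ∀ x, e (Sum.inl x) = x := fun _ => rfl
      have he₂ : ∀ k, e (Sum.inr k) = ρ k := fun _ => rfl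
      have hρ' : ∀ k, φ (ρ k) = k := hρ
      simp [he₁, he₂, hρ']
  have hd := congrArg Matrix.det hmul
  rw [Matrix.det_mul, Matrix.det_fromBlocks_zero₁₂, Matrix.det_fromBlocks_zero₂₁,
    Matrix.det_one, Matrix.det_one, one_mul, one_mul, Matrix.det_diagonal] at hd
  rw [hd, abs_mul, Finset.abs_prod, Finset.prod_eq_one, one_mul]
  intro i _
  simp only [s]
  split_ifs <;> simp

theorem blockSum_addCases {n m k : ℕ} (φ : Fin n → Fin k) (χ : Fin m → Fin k)
    (w : Fin (n + m) → ℤ) (v : Fin n → ℤ) (t : Fin m)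
    (hv : ∀ i, w (Fin.castAdd m i) = v i)
    (ht : ∀ u, w (Fin.natAdd n u) = if u = t then 1 else 0) (l : Fin k) :
    blockSum (Fin.addCases φ χ) w l = extBlockSum φ (χ t) v l := by
  simp only [blockSum, extBlockSum, Fin.sum_univ_add, Fin.addCases_left, Fin.addCases_right, hv, ht]
  congr 1
  rw [Finset.sum_eq_single t (fun u _ hu => by simp [hu]) (by simp)]
  simp

theorem exists_pos_or_eq_neg_single {n : ℕ} (v : Fin n → ℤ) (hsum : ∑ i, v i = -1) :
    (∃ i, 0 < v i) ∨ ∃ i, v = Pi.single i (-1) := by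
  by_contra! h
  obtain ⟨hneg, hne⟩ := h
  obtain ⟨i, hi⟩ : ∃ i, v i < 0 := by
    by_contra! h0
    have := Finset.sum_nonneg fun i (_ : i ∈ Finset.univ) => h0 i
    omega
  apply hne i
  have hsplit := Finset.add_sum_erase Finset.univ v (Finset.mem_univ i)
  have hle : ∑ j ∈ Finset.univ.erase i, v j ≤ 0 := Finset.sum_nonpos fun j _ => hneg j
  have hz := (Finset.sum_eq_zero_iff_of_nonpos fun j _ => hneg j).1
    (show ∑ j ∈ Finset.univ.erase i, v j = 0 by omega)
  funext j
  by_cases hj : j = i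
  · subst hj
    simp only [Pi.single_eq_same]
    omega
  · rw [Pi.single_eq_of_ne hj]
    exact hz j (by simp [hj])

theorem no_three_element_independent_flats (r : ℕ) (hr : 3 ≤ r)
    (a b c : Fin (r - 2) → ℤ)
    (hab : a ≠ b) (hac : a ≠ c) (hbc : b ≠ c)
    (hsuma : ∑ i, a i = -1) (hsumb : ∑ i, b i = -1) (hsumc : ∑ i, c i = -1)
    (A : Matrix (Fin (r + 1)) (PairIdx (r + 1) ⊕ Fin 3) ℤ)
    (hA : A = Matrix.of fun i =>
      Sum.elim (fun p => Dmat (r + 1) i p)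
        (fun t =>
          if h : i.val < r - 2 then
            (![a, b, c] t) ⟨i.val, h⟩
          else if i.val = r - 2 + t.val then 1 else 0))
    (hnonpar : ∀ j j', j ≠ j' → ¬ IntParallel (fun i => A i j) (fun i => A i j')) :
    ∃ (g : Fin r → Fin (r + 1)) (f : Fin r → PairIdx (r + 1) ⊕ Fin 3),
      Function.Injective g ∧ Function.Injective f ∧
      4 ≤ |(A.submatrix g f).det| := by
  by_contra! hbound
  obtain ⟨n, rfl⟩ : ∃ n, r = n + 2 := ⟨r - 2, by omega⟩
  change Fin n → ℤ at a b c
  let v : Fin 3 → Fin n → ℤ := ![a, b, c]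
  have hD : ∀ i p, A i (Sum.inl p) = Dmat (n + 2 + 1) i p := fun i p => by rw [hA]; rfl
  have hv : ∀ t (i : Fin n), A (Fin.castAdd 3 i) (Sum.inr t) = v t i := fun t i => by
    rw [hA]
    exact dif_pos i.2
  have hone : ∀ t u : Fin 3, A (Fin.natAdd n u) (Sum.inr t) = if u = t then 1 else 0 :=
    fun t u => by
    rw [hA]
    simp [Fin.ext_iff]
  have hvsum : ∀ t, ∑ i, v t i = -1 := by
    intro t
    fin_cases t
    exacts [hsuma, hsumb, hsumc]
  have hinj : Function.Injective v := by
    intro s t h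
    fin_cases s <;> fin_cases t <;>
      first
      | rfl
      | exact absurd h hab
      | exact absurd h hac
      | exact absurd h hbc
      | exact absurd h.symm hab
      | exact absurd h.symm hac
      | exact absurd h.symm hbc
  have hcol : ∀ t, ∑ i, A i (Sum.inr t) = 0 := by
    intro t
    refine (Fin.sum_univ_add (a := n) (b := 3) fun i => A i (Sum.inr t)).trans ?_
    simp [hv, hone, hvsum]
  have hblock : ∀ (m : ℕ) (κ : Fin m → Fin 3), Function.Injective κ →
      ∀ (φ : Fin n → Fin (m + 1)) (χ : Fin 3 → Fin (m + 1)),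
      |(Matrix.of fun k t : Fin m =>
        extBlockSum φ (χ (κ t)) (v (κ t)) k.castSucc).det| ≤ 3 := by
    intro m κ hκ φ χ
    by_contra! hlt
    have heq : (Matrix.of fun k t : Fin m =>
        extBlockSum φ (χ (κ t)) (v (κ t)) k.castSucc) = Matrix.of fun k t : Fin m =>
        blockSum (Fin.addCases φ χ : Fin (n + 3) → Fin (m + 1))
          (fun i => A i (Sum.inr (κ t))) k.castSucc := by
      ext k t
      exact (blockSum_addCases φ χ _ _ _ (hv _) (hone _) _).symm
    rw [heq] at hlt
    obtain ⟨g, f, hg, hf, h⟩ := exists_submatrix_of_block_det A hD hcol κ hκ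
      (Fin.addCases φ χ : Fin (n + 3) → Fin (m + 1)) (fun h0 => by simp [h0] at hlt)
    exact absurd (h.symm.trans_lt (hbound g f hg hf)) (not_lt.2 hlt)
  have hpos : ∀ t, ∃ i, 0 < v t i := by
    intro t
    refine (exists_pos_or_eq_neg_single (v t) (hvsum t)).resolve_right ?_
    rintro ⟨i, hi⟩
    have hlt : (Fin.castAdd 3 i : Fin (n + 3)) < Fin.natAdd n t := by
      simp only [Fin.lt_def, Fin.val_castAdd, Fin.val_natAdd]
      omega
    refine hnonpar (Sum.inr t) (Sum.inl ⟨(Fin.castAdd 3 i, Fin.natAdd n t), hlt⟩) (by simp)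
      fun hli => ?_
    have h := (LinearIndependent.pair_iff.1 hli 1 1 ?_).1
    · exact one_ne_zero h
    · funext j
      simp only [one_smul, Pi.add_apply, Pi.zero_apply, hD]
      norm_cast
      induction j using Fin.addCases (m := n) (n := 3) with
      | left j =>
        rw [hv, hi]
        simp [Dmat, Pi.single_apply, Fin.ext_iff]
        split_ifs <;> omega
      | right u =>
        rw [hone]
        simp [Dmat, Fin.ext_iff]
        split_ifs <;> omega
  refine not_forall_bound hinj hvsum hpos ?_ ?_ ?_
  · intro t φ x
    simpa using hblock 1 ![t] (Function.injective_of_subsingleton _) φ fun _ => x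
  · intro s t hst φ x y
    have h := hblock 2 ![s, t] (by simp [Function.Injective, Fin.forall_fin_succ, hst, hst.symm]) φ
      fun u => if u = s then x else y
    rw [Matrix.det_fin_two] at h
    simp [hst.symm] at h
    unfold pairDet
    convert h using 2
  · intro s t u hst hsu htu φ x y z
    have h := hblock 3 ![s, t, u] (by
      simp [Function.Injective, Fin.forall_fin_succ, hst, hsu, htu, hst.symm, hsu.symm,
        htu.symm]) φ
      fun w => if w = s then x else if w = t then y else z
    rw [Matrix.det_fin_three] at h
    simp [hst.symm, hsu.symm, htu.symm] at h
    unfold tripleDet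
    convert h using 2
    ring
end
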